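/- arXiv:2008.09362 — 2 statements merged into one kernel-verified Lean document; each statement's English description precedes it below -/
import Mathlib

section
/- Let n ≥ 1, q > 1, and let μ be a probability measure on ℝⁿ with finite first moment, zero barycenter, and not supported on any affine hyperplane. Then the minimizer of J(ρ) = F(ρ) + T(ρ,μ) over P_1(ℝⁿ) is unique up to translation: if ρ̄₀ and ρ̄₁ are both minimizers, then there exists v ∈ ℝⁿ such that ρ̄₁ is the image of ρ̄₀ under the translation x ↦ x + v. -/
open MeasureTheory Topology Filter Set
open scoped ENNReal RealInnerProductSpace

noncomputable section

abbrev En (n : ℕ) : Type := EuclideanSpace ℝ (Fin n)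

/-- The positive part of an extended real number, as an element of `ℝ≥0∞`. -/
def posPartNN (x : EReal) : ℝ≥0∞ := if x = ⊤ then ⊤ else ENNReal.ofReal x.toReal

/-- The integral of an `EReal`-valued function, with values in `EReal`
(defined as the integral of the positive part minus that of the negative part). -/
def eInt {X : Type*} [MeasurableSpace X] (ρ : Measure X) (g : X → EReal) : EReal :=
  ((∫⁻ x, posPartNN (g x) ∂ρ : ℝ≥0∞) : EReal) - ((∫⁻ x, posPartNN (-(g x)) ∂ρ : ℝ≥0∞) : EReal)

/-- Transport plans between `ρ` and `μ`. -/
def Plans {n : ℕ} (ρ μ : Measure (En n)) : Set (Measure (En n × En n)) :=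
  {γ | IsProbabilityMeasure γ ∧ γ.map Prod.fst = ρ ∧ γ.map Prod.snd = μ}

/-- The maximal correlation functional `T(ρ,μ)`. -/
def Tcorr {n : ℕ} (ρ μ : Measure (En n)) : EReal :=
  ⨆ γ ∈ Plans ρ μ, eInt γ (fun p => ((⟪p.1, p.2⟫ : ℝ) : EReal))

/-- The local functional `F(ρ) = ∫ f(ρ^ac) dx` with `f(t) = -t^α/α`, `α = 1 - 1/(n+q)`. -/
def Ffun (n : ℕ) (q : ℝ) (ρ : Measure (En n)) : EReal :=
  - ((∫⁻ x, ENNReal.ofReal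
      ((ρ.rnDeriv volume x).toReal ^ (1 - 1/((n : ℝ) + q)) / (1 - 1/((n : ℝ) + q)))
      ∂volume : ℝ≥0∞) : EReal)

/-- The functional `J(ρ) = F(ρ) + T(ρ,μ)`. -/
def Jfun (n : ℕ) (q : ℝ) (μ ρ : Measure (En n)) : EReal := Ffun n q ρ + Tcorr ρ μ

/-- Finite first moment. -/
def P1 {n : ℕ} (ρ : Measure (En n)) : Prop := Integrable (fun x : En n => ‖x‖) ρ

/-- `μ` is not supported on any affine hyperplane. -/
def NotHyperplane {n : ℕ} (μ : Measure (En n)) : Prop :=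
  ∀ (e : En n) (ℓ : ℝ), e ≠ 0 → μ {x | ⟪x, e⟫ = ℓ} ≠ 1

theorem eInt_coe {X : Type*} [MeasurableSpace X] (γ : Measure X) (h : X → ℝ) :
    eInt γ (fun p => ((h p : ℝ) : EReal)) =
      ((∫⁻ x, ENNReal.ofReal (h x) ∂γ : ℝ≥0∞) : EReal)
        - ((∫⁻ x, ENNReal.ofReal (-h x) ∂γ : ℝ≥0∞) : EReal) := by
  unfold eInt
  congr 3

theorem integrable_of_lintegral_ofReal {X : Type*} [MeasurableSpace X] {γ : Measure X} {h : X → ℝ}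
    (hm : Measurable h) (hp : ∫⁻ x, ENNReal.ofReal (h x) ∂γ ≠ ∞)
    (hn : ∫⁻ x, ENNReal.ofReal (-h x) ∂γ ≠ ∞) : Integrable h γ := by
  refine ⟨hm.aestronglyMeasurable, ?_⟩
  have : ∀ x, ‖h x‖ₑ ≤ ENNReal.ofReal (h x) + ENNReal.ofReal (-h x) := by
    intro x
    rw [Real.enorm_eq_ofReal_abs]
    rcases le_total 0 (h x) with h0 | h0
    · rw [abs_of_nonneg h0]; exact le_self_add
    · rw [abs_of_nonpos h0]; exact le_add_self
  refine (lintegral_mono this).trans_lt ?_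
  rw [lintegral_add_left hm.ennreal_ofReal]
  exact ENNReal.add_lt_top.2 ⟨hp.lt_top, hn.lt_top⟩

theorem lintegral_ofReal_ne_top {X : Type*} [MeasurableSpace X] {γ : Measure X} {h : X → ℝ}
    (hi : Integrable h γ) : ∫⁻ x, ENNReal.ofReal (h x) ∂γ ≠ ∞ := by
  refine ((lintegral_mono fun x => ?_).trans_lt hi.2).ne
  rw [Real.enorm_eq_ofReal_abs]
  exact ENNReal.ofReal_le_ofReal (le_abs_self _)

theorem eInt_coe_of_integrable {X : Type*} [MeasurableSpace X] {γ : Measure X} {h : X → ℝ}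
    (hi : Integrable h γ) :
    eInt γ (fun p => ((h p : ℝ) : EReal)) = ((∫ x, h x ∂γ : ℝ) : EReal) := by
  have h1 := lintegral_ofReal_ne_top hi
  have h2 : ∫⁻ x, ENNReal.ofReal (-h x) ∂γ ≠ ∞ := lintegral_ofReal_ne_top hi.neg
  rw [eInt_coe, integral_eq_lintegral_pos_part_sub_lintegral_neg_part hi, EReal.coe_sub,
    EReal.coe_ennreal_toReal h1, EReal.coe_ennreal_toReal h2]

section Correlation

variable {n : ℕ} {ρ μ : Measure (En n)}

theorem measurable_inner_prod : Measurable (fun p : En n × En n => (⟪p.1, p.2⟫ : ℝ)) :=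
  (continuous_fst.inner continuous_snd).measurable

theorem lintegral_pos_ne_top_of_mem_plans (hρ : P1 ρ) (hμ : P1 μ) (hT : Tcorr ρ μ ≠ ⊤)
    {γ : Measure (En n × En n)} (hγ : γ ∈ Plans ρ μ) :
    ∫⁻ p, ENNReal.ofReal ⟪p.1, p.2⟫ ∂γ ≠ ∞ := by
  intro htop
  apply hT
  obtain ⟨hprob, h1, h2⟩ := hγ
  set P : Set (En n × En n) := {p | 0 < (⟪p.1, p.2⟫ : ℝ)} with hP
  have hPm : MeasurableSet P := measurableSet_lt measurable_const measurable_inner_prod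
  set c := γ Pᶜ
  have hc : c ≠ ∞ := measure_ne_top _ _
  set ν₁ := (γ.restrict Pᶜ).map Prod.fst
  set ν₂ := (γ.restrict Pᶜ).map Prod.snd
  have hν₁ : ν₁ univ = c := by
    rw [Measure.map_apply measurable_fst MeasurableSet.univ]; simp [c]
  have hν₂ : ν₂ univ = c := by
    rw [Measure.map_apply measurable_snd MeasurableSet.univ]; simp [c]
  set γ' := γ.restrict P + c⁻¹ • ν₁.prod ν₂ with hγ'
  have key : ∀ ν : Measure (En n), ν univ = c → c⁻¹ • c • ν = ν := by
    intro ν hν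
    by_cases h0 : c = 0
    · rw [h0] at hν
      rw [Measure.measure_univ_eq_zero.1 hν]; simp
    · rw [smul_smul, ENNReal.inv_mul_cancel h0 hc, one_smul]
  have hf : γ'.map Prod.fst = ρ := by
    rw [hγ', Measure.map_add _ _ measurable_fst, Measure.map_smul, Measure.map_fst_prod, hν₂,
      key _ hν₁, ← Measure.map_add _ _ measurable_fst, Measure.restrict_add_restrict_compl hPm, h1]
  have hs : γ'.map Prod.snd = μ := by
    rw [hγ', Measure.map_add _ _ measurable_snd, Measure.map_smul, Measure.map_snd_prod, hν₁,
      key _ hν₂, ← Measure.map_add _ _ measurable_snd, Measure.restrict_add_restrict_compl hPm, h2]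
  have hmem : γ' ∈ Plans ρ μ := by
    refine ⟨⟨?_⟩, hf, hs⟩
    have : γ'.map Prod.fst univ = γ.map Prod.fst univ := by rw [hf, h1]
    rw [Measure.map_apply measurable_fst MeasurableSet.univ,
      Measure.map_apply measurable_fst MeasurableSet.univ] at this
    simpa using this
  have hpos : ∫⁻ p, ENNReal.ofReal ⟪p.1, p.2⟫ ∂γ' = ∞ := by
    rw [eq_top_iff, ← htop, hγ', lintegral_add_measure, ← lintegral_add_compl _ hPm]
    refine add_le_add le_rfl ?_
    rw [setLIntegral_congr_fun (g := fun _ => 0) hPm.compl]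
    · simp
    · intro p hp
      exact ENNReal.ofReal_of_nonpos (not_lt.1 hp)
  have hneg : ∫⁻ p, ENNReal.ofReal (-⟪p.1, p.2⟫) ∂γ' ≠ ∞ := by
    rw [hγ', lintegral_add_measure, setLIntegral_congr_fun (g := fun _ => 0) hPm, lintegral_zero,
      zero_add, lintegral_smul_measure]
    · by_cases h0 : c = 0
      · have : ν₁ = 0 := Measure.measure_univ_eq_zero.1 (hν₁.trans h0)
        simp [this]
      · refine ENNReal.mul_ne_top (ENNReal.inv_ne_top.2 h0) ?_
        have i1 : Integrable (fun x : En n => ‖x‖) ν₁ := by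
          have : Integrable (fun x : En n => ‖x‖) (γ.map Prod.fst) := by rw [h1]; exact hρ
          exact this.mono_measure (Measure.map_mono Measure.restrict_le_self measurable_fst)
        have i2 : Integrable (fun x : En n => ‖x‖) ν₂ := by
          have : Integrable (fun x : En n => ‖x‖) (γ.map Prod.snd) := by rw [h2]; exact hμ
          exact this.mono_measure (Measure.map_mono Measure.restrict_le_self measurable_snd)
        have i3 := lintegral_ofReal_ne_top (i1.mul_prod i2)
        refine ne_top_of_le_ne_top i3 (lintegral_mono fun p => ENNReal.ofReal_le_ofReal ?_)
        rw [← inner_neg_left]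
        exact (real_inner_le_norm _ _).trans (by rw [norm_neg])
    · intro p hp
      exact ENNReal.ofReal_of_nonpos (by simpa using le_of_lt hp)
  rw [eq_top_iff]
  refine le_trans ?_ (le_iSup₂_of_le γ' hmem le_rfl)
  rw [eInt_coe, hpos, EReal.coe_ennreal_top, EReal.top_sub]
  simpa using hneg

theorem integral_le_of_mem_plans {c : ℝ} (hT : Tcorr ρ μ ≤ c)
    {γ : Measure (En n × En n)} (hγ : γ ∈ Plans ρ μ)
    (hi : Integrable (fun p : En n × En n => (⟪p.1, p.2⟫ : ℝ)) γ) :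
    ∫ p, (⟪p.1, p.2⟫ : ℝ) ∂γ ≤ c := by
  have := (le_iSup₂_of_le (f := fun γ (_ : γ ∈ Plans ρ μ) =>
    eInt γ (fun p => ((⟪p.1, p.2⟫ : ℝ) : EReal))) γ hγ le_rfl).trans hT
  rw [eInt_coe_of_integrable hi] at this
  exact_mod_cast this

theorem Tcorr_le {c : ℝ}
    (h : ∀ γ ∈ Plans ρ μ, ∫⁻ p, ENNReal.ofReal ⟪p.1, p.2⟫ ∂γ ≠ ∞ ∧
      (Integrable (fun p : En n × En n => (⟪p.1, p.2⟫ : ℝ)) γ → ∫ p, (⟪p.1, p.2⟫ : ℝ) ∂γ ≤ c)) :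
    Tcorr ρ μ ≤ c := by
  refine iSup₂_le fun γ hγ => ?_
  obtain ⟨hp, hi⟩ := h γ hγ
  by_cases hn : ∫⁻ p, ENNReal.ofReal (-⟪p.1, p.2⟫) ∂γ = ∞
  · rw [eInt_coe, hn]; simp
  · have hinner := integrable_of_lintegral_ofReal measurable_inner_prod hp hn
    rw [eInt_coe_of_integrable hinner]
    exact_mod_cast hi hinner

theorem Tcorr_ne_bot [IsProbabilityMeasure ρ] [IsProbabilityMeasure μ] (hρ : P1 ρ) (hμ : P1 μ) :
    Tcorr ρ μ ≠ ⊥ := by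
  have hmem : ρ.prod μ ∈ Plans ρ μ := ⟨inferInstance, by simp, by simp⟩
  have hi : Integrable (fun p : En n × En n => (⟪p.1, p.2⟫ : ℝ)) (ρ.prod μ) := by
    refine (hρ.mul_prod hμ).mono' measurable_inner_prod.aestronglyMeasurable (ae_of_all _ fun p => ?_)
    exact norm_inner_le_norm _ _
  have := le_iSup₂_of_le (f := fun γ (_ : γ ∈ Plans ρ μ) =>
    eInt γ (fun p => ((⟪p.1, p.2⟫ : ℝ) : EReal))) _ hmem le_rfl
  rw [eInt_coe_of_integrable hi] at this
  exact ne_bot_of_le_ne_bot (EReal.coe_ne_bot _) this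

/-- Any plan of the law of `g` lifts to a plan on the source of `g`. -/
theorem exists_lift_plan {Z : Type*} [MeasurableSpace Z] (π : Measure Z) [IsProbabilityMeasure π]
    {g : Z → En n} (hg : Measurable g) {γ : Measure (En n × En n)}
    (hγ : γ ∈ Plans (π.map g) μ) :
    ∃ Γ : Measure (Z × En n), IsProbabilityMeasure Γ ∧ Γ.map Prod.fst = π ∧
      Γ.map (fun p => (g p.1, p.2)) = γ := by
  obtain ⟨hprob, h1, h2⟩ := hγ
  refine ⟨π.compProd (γ.condKernel.comap g hg), inferInstance, Measure.fst_compProd _ _, ?_⟩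
  have hm : Measurable (fun p : Z × En n => (g p.1, p.2)) := by fun_prop
  ext s hs
  rw [Measure.map_apply hm hs, Measure.compProd_apply (hm hs)]
  conv_rhs => rw [← γ.disintegrate γ.condKernel]
  rw [Measure.compProd_apply hs, show γ.fst = π.map g from h1, lintegral_map _ hg]
  · rfl
  · exact ProbabilityTheory.Kernel.measurable_kernel_prodMk_left hs

theorem Tcorr_map_add_le {Z : Type*} [MeasurableSpace Z] (π : Measure Z) [IsProbabilityMeasure π]
    {X Y : Z → En n} (hX : Measurable X) (hY : Measurable Y) (hμ : P1 μ)
    (hX1 : P1 (π.map X)) (hY1 : P1 (π.map Y)) {a b c d : ℝ} (ha : 0 ≤ a) (hb : 0 ≤ b)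
    (hTX : Tcorr (π.map X) μ ≤ c) (hTY : Tcorr (π.map Y) μ ≤ d) :
    Tcorr (π.map (fun z => a • X z + b • Y z)) μ ≤ ((a * c + b * d : ℝ) : EReal) := by
  refine Tcorr_le fun γ hγ => ?_
  have hg : Measurable (fun z => a • X z + b • Y z) := by fun_prop
  obtain ⟨Γ, hΓ, hΓ1, hΓγ⟩ := exists_lift_plan π hg hγ
  have hm : Measurable (fun p : Z × En n => (a • X p.1 + b • Y p.1, p.2)) := by fun_prop
  have hΓ2 : Γ.map Prod.snd = μ := by
    rw [← hγ.2.2, ← hΓγ, Measure.map_map measurable_snd hm]; rfl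
  have plan : ∀ W : Z → En n, Measurable W →
      Γ.map (fun p => (W p.1, p.2)) ∈ Plans (π.map W) μ := by
    intro W hW
    have hmW : Measurable (fun p : Z × En n => (W p.1, p.2)) := by fun_prop
    refine ⟨Measure.isProbabilityMeasure_map hmW.aemeasurable, ?_, ?_⟩
    · rw [Measure.map_map measurable_fst hmW, ← hΓ1, Measure.map_map hW measurable_fst]; rfl
    · rw [Measure.map_map measurable_snd hmW, ← hΓ2]; rfl
  have mW : ∀ W : Z → En n, Measurable W → Measurable (fun p : Z × En n => (⟪W p.1, p.2⟫ : ℝ)) :=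
    fun W hW => (hW.comp measurable_fst).inner measurable_snd
  have pos : ∀ W : Z → En n, Measurable W → P1 (π.map W) → Tcorr (π.map W) μ ≠ ⊤ →
      ∫⁻ p, ENNReal.ofReal ⟪W p.1, p.2⟫ ∂Γ ≠ ∞ := by
    intro W hW hW1 hWT
    have := lintegral_pos_ne_top_of_mem_plans hW1 hμ hWT (plan W hW)
    rwa [lintegral_map measurable_inner_prod.ennreal_ofReal (by fun_prop)] at this
  have pX := pos X hX hX1 (ne_top_of_le_ne_top (EReal.coe_ne_top _) hTX)
  have pY := pos Y hY hY1 (ne_top_of_le_ne_top (EReal.coe_ne_top _) hTY)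
  have le_int : ∀ (W : Z → En n) (e : ℝ), Measurable W → Tcorr (π.map W) μ ≤ e →
      Integrable (fun p : Z × En n => (⟪W p.1, p.2⟫ : ℝ)) Γ →
      ∫ p, (⟪W p.1, p.2⟫ : ℝ) ∂Γ ≤ e := by
    intro W e hW hT hi
    have hmW : Measurable (fun p : Z × En n => (W p.1, p.2)) := by fun_prop
    have := integral_le_of_mem_plans hT (plan W hW)
      ((integrable_map_measure measurable_inner_prod.aestronglyMeasurable hmW.aemeasurable).2 hi)
    rwa [integral_map hmW.aemeasurable measurable_inner_prod.aestronglyMeasurable] at this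
  have split : ∀ p : Z × En n, (⟪a • X p.1 + b • Y p.1, p.2⟫ : ℝ)
      = a * ⟪X p.1, p.2⟫ + b * ⟪Y p.1, p.2⟫ := by
    intro p; rw [inner_add_left, real_inner_smul_left, real_inner_smul_left]
  have scale : ∀ (W : Z → En n) (e : ℝ), Measurable W → 0 ≤ e →
      ∫⁻ p, ENNReal.ofReal ⟪W p.1, p.2⟫ ∂Γ ≠ ∞ →
      ∫⁻ p, ENNReal.ofReal (e * ⟪W p.1, p.2⟫) ∂Γ ≠ ∞ := by
    intro W e hW he h
    simp_rw [ENNReal.ofReal_mul he]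
    rw [lintegral_const_mul _ (mW W hW).ennreal_ofReal]
    exact ENNReal.mul_ne_top ENNReal.ofReal_ne_top h
  have paX := scale X a hX ha pX
  have pbY := scale Y b hY hb pY
  rw [← hΓγ, lintegral_map measurable_inner_prod.ennreal_ofReal hm,
    integrable_map_measure measurable_inner_prod.aestronglyMeasurable hm.aemeasurable,
    integral_map hm.aemeasurable measurable_inner_prod.aestronglyMeasurable]
  simp only [split, Function.comp_def]
  have maX : Measurable (fun p : Z × En n => a * (⟪X p.1, p.2⟫ : ℝ)) := (mW X hX).const_mul a
  have mbY : Measurable (fun p : Z × En n => b * (⟪Y p.1, p.2⟫ : ℝ)) := (mW Y hY).const_mul b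
  refine ⟨?_, fun hi => ?_⟩
  · refine ((lintegral_mono fun p => ENNReal.ofReal_add_le).trans_lt ?_).ne
    rw [lintegral_add_left maX.ennreal_ofReal]
    exact ENNReal.add_lt_top.2 ⟨paX.lt_top, pbY.lt_top⟩
  · have hneg := lintegral_ofReal_ne_top hi.neg
    have iaX : Integrable (fun p : Z × En n => a * (⟪X p.1, p.2⟫ : ℝ)) Γ := by
      refine integrable_of_lintegral_ofReal maX paX ?_
      refine ((lintegral_mono (g := fun p : Z × En n =>
        ENNReal.ofReal (-(a * (⟪X p.1, p.2⟫ : ℝ) + b * ⟪Y p.1, p.2⟫))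
          + ENNReal.ofReal (b * ⟪Y p.1, p.2⟫)) fun p => ?_).trans_lt ?_).ne
      · refine le_trans (le_of_eq ?_) ENNReal.ofReal_add_le
        congr 1; ring
      · rw [lintegral_add_right _ mbY.ennreal_ofReal]
        exact ENNReal.add_lt_top.2 ⟨hneg.lt_top, pbY.lt_top⟩
    have ibY : Integrable (fun p : Z × En n => b * (⟪Y p.1, p.2⟫ : ℝ)) Γ := by
      refine (hi.sub iaX).congr (ae_of_all _ fun p => ?_)
      simp
    rw [integral_add iaX ibY, integral_const_mul, integral_const_mul]
    have e1 : a * ∫ p, (⟪X p.1, p.2⟫ : ℝ) ∂Γ ≤ a * c := by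
      rcases ha.eq_or_lt with rfl | ha'
      · simp
      · refine mul_le_mul_of_nonneg_left (le_int X c hX hTX ?_) ha
        exact (integrable_const_mul_iff (IsUnit.mk0 _ ha'.ne') _).1 iaX
    have e2 : b * ∫ p, (⟪Y p.1, p.2⟫ : ℝ) ∂Γ ≤ b * d := by
      rcases hb.eq_or_lt with rfl | hb'
      · simp
      · refine mul_le_mul_of_nonneg_left (le_int Y d hY hTY ?_) hb
        exact (integrable_const_mul_iff (IsUnit.mk0 _ hb'.ne') _).1 ibY
    linarith

theorem Tcorr_le_of_norm_le (hμ : P1 μ) {r : ℝ} (h : ∀ᵐ x ∂ρ, ‖x‖ ≤ r) :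
    Tcorr ρ μ ≤ ((r * ∫ y, ‖y‖ ∂μ : ℝ) : EReal) := by
  refine Tcorr_le fun γ hγ => ?_
  obtain ⟨hprob, h1, h2⟩ := hγ
  have hx : ∀ᵐ p ∂γ, ‖p.1‖ ≤ r := by
    rw [← h1] at h
    exact ae_of_ae_map measurable_fst.aemeasurable h
  have hi : Integrable (fun p : En n × En n => r * ‖p.2‖) γ := by
    have : Integrable (fun x : En n => ‖x‖) (γ.map Prod.snd) := by rw [h2]; exact hμ
    exact (this.comp_measurable measurable_snd).const_mul r
  have hle : ∀ᵐ p ∂γ, ‖(⟪p.1, p.2⟫ : ℝ)‖ ≤ r * ‖p.2‖ := by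
    filter_upwards [hx] with p hp
    exact (norm_inner_le_norm _ _).trans (by gcongr)
  have hI : Integrable (fun p : En n × En n => (⟪p.1, p.2⟫ : ℝ)) γ :=
    hi.mono' measurable_inner_prod.aestronglyMeasurable hle
  refine ⟨lintegral_ofReal_ne_top hI, fun _ => ?_⟩
  calc ∫ p, (⟪p.1, p.2⟫ : ℝ) ∂γ ≤ ∫ p, r * ‖p.2‖ ∂γ :=
        integral_mono_ae hI hi (hle.mono fun p hp => (le_abs_self _).trans hp)
    _ = r * ∫ y, ‖y‖ ∂μ := by
        rw [integral_const_mul, ← h2, integral_map measurable_snd.aemeasurable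
          (by fun_prop)]

end Correlation

/-- The integral of the power `α` of the density of the absolutely continuous part. -/
def powInt {n : ℕ} (α : ℝ) (ρ : Measure (En n)) : ℝ≥0∞ := ∫⁻ x, ρ.rnDeriv volume x ^ α

theorem Ffun_eq {n : ℕ} {q : ℝ} (ρ : Measure (En n)) [IsFiniteMeasure ρ]
    (hα : 0 < 1 - 1 / ((n : ℝ) + q)) :
    Ffun n q ρ = -((powInt (1 - 1 / ((n : ℝ) + q)) ρ
      / ENNReal.ofReal (1 - 1 / ((n : ℝ) + q)) : ℝ≥0∞) : EReal) := by
  unfold Ffun powInt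
  congr 2
  simp_rw [div_eq_mul_inv (_ : ℝ≥0∞) (ENNReal.ofReal (1 - 1 / ((n : ℝ) + q)))]
  rw [← lintegral_mul_const' _ _ (by simpa using hα)]
  refine lintegral_congr_ae ?_
  filter_upwards [ρ.rnDeriv_lt_top volume] with x hx
  rw [ENNReal.ofReal_div_of_pos hα, ← ENNReal.ofReal_rpow_of_nonneg ENNReal.toReal_nonneg hα.le,
    ENNReal.ofReal_toReal hx.ne, div_eq_mul_inv]

theorem powInt_ne_top {n : ℕ} {N : ℝ} (hN : (n : ℝ) + 1 < N) (ρ : Measure (En n))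
    [IsFiniteMeasure ρ] (hρ : P1 ρ) : powInt (1 - 1 / N) ρ ≠ ∞ := by
  have hN1 : 1 < N := by have : (0 : ℝ) ≤ n := n.cast_nonneg; linarith
  have hα : 0 < 1 - 1 / N := by rw [sub_pos, div_lt_one (by linarith)]; exact hN1
  have bound : ∀ x : En n, ∀ r : ℝ≥0∞, r ≠ ∞ → r ^ (1 - 1 / N) ≤
      r * ENNReal.ofReal (1 + ‖x‖) + ENNReal.ofReal ((1 + ‖x‖) ^ (-(N - 1))) := by
    intro x r hr
    lift r to NNReal using hr
    have hw : 0 < 1 + ‖x‖ := by positivity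
    rw [← ENNReal.ofReal_coe_nnreal, ENNReal.ofReal_rpow_of_nonneg r.coe_nonneg hα.le,
      ← ENNReal.ofReal_mul r.coe_nonneg, ← ENNReal.ofReal_add (by positivity) (by positivity)]
    refine ENNReal.ofReal_le_ofReal ?_
    have hr0 : (0 : ℝ) ≤ r := r.coe_nonneg
    rcases le_or_gt (r : ℝ) ((1 + ‖x‖) ^ (-N)) with h | h
    · calc (r : ℝ) ^ (1 - 1 / N) ≤ ((1 + ‖x‖) ^ (-N)) ^ (1 - 1 / N) := by gcongr
        _ = (1 + ‖x‖) ^ (-(N - 1)) := by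
            rw [← Real.rpow_mul hw.le]; congr 1; field_simp
        _ ≤ _ := by have : 0 ≤ (r : ℝ) * (1 + ‖x‖) := by positivity
                    linarith
    · have hrp : (0 : ℝ) < r := lt_trans (by positivity) h
      have : (r : ℝ) ^ (-(1 / N)) ≤ 1 + ‖x‖ := by
        calc (r : ℝ) ^ (-(1 / N)) ≤ ((1 + ‖x‖) ^ (-N)) ^ (-(1 / N)) :=
              Real.rpow_le_rpow_of_nonpos (by positivity) h.le (by rw [neg_nonpos]; positivity)
          _ = 1 + ‖x‖ := by
              rw [← Real.rpow_mul hw.le, neg_mul_neg, mul_one_div_cancel (by linarith),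
                Real.rpow_one]
      rw [sub_eq_add_neg, Real.rpow_add hrp, Real.rpow_one]
      have h2 : 0 ≤ (1 + ‖x‖) ^ (-(N - 1)) := by positivity
      nlinarith [mul_le_mul_of_nonneg_left this hr0]
  have i1 : ∫⁻ x, ρ.rnDeriv volume x * ENNReal.ofReal (1 + ‖x‖) ≠ ∞ := by
    have hi : Integrable (fun x : En n => 1 + ‖x‖) ρ := (integrable_const 1).add hρ
    have h1 := lintegral_ofReal_ne_top hi
    refine ne_top_of_le_ne_top h1 ?_
    calc ∫⁻ x, ρ.rnDeriv volume x * ENNReal.ofReal (1 + ‖x‖)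
        = ∫⁻ x, ENNReal.ofReal (1 + ‖x‖) ∂(volume.withDensity (ρ.rnDeriv volume)) := by
          rw [lintegral_withDensity_eq_lintegral_mul _ (Measure.measurable_rnDeriv _ _)
            (by fun_prop)]; rfl
      _ ≤ _ := lintegral_mono' (Measure.withDensity_rnDeriv_le _ _) le_rfl
  have i2 : ∫⁻ x : En n, ENNReal.ofReal ((1 + ‖x‖) ^ (-(N - 1))) ≠ ∞ := by
    refine lintegral_ofReal_ne_top (integrable_one_add_norm (μ := volume) (E := En n) ?_)
    rw [finrank_euclideanSpace_fin]; linarith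
  refine ((lintegral_mono_ae (g := fun x => ρ.rnDeriv volume x * ENNReal.ofReal (1 + ‖x‖)
    + ENNReal.ofReal ((1 + ‖x‖) ^ (-(N - 1)))) ?_).trans_lt ?_).ne
  · filter_upwards [ρ.rnDeriv_lt_top volume] with x hx using bound x _ hx.ne
  · rw [lintegral_add_right _ (by fun_prop)]
    exact ENNReal.add_lt_top.2 ⟨i1.lt_top, i2.lt_top⟩

/-- Minimality in terms of real numbers. -/
theorem powInt_le_of_isMin {n : ℕ} {q : ℝ} (hq : 1 < q) {μ : Measure (En n)}
    [IsProbabilityMeasure μ] (hμ1 : P1 μ) {ρ₀ : Measure (En n)} [IsProbabilityMeasure ρ₀]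
    (hρ₀1 : P1 ρ₀)
    (hmin : ∀ ρ : Measure (En n), IsProbabilityMeasure ρ → P1 ρ → Jfun n q μ ρ₀ ≤ Jfun n q μ ρ) :
    ∃ τ : ℝ, Tcorr ρ₀ μ ≤ τ ∧ ∀ ρ : Measure (En n), IsProbabilityMeasure ρ → P1 ρ →
      ∀ c : ℝ, Tcorr ρ μ ≤ c → (powInt (1 - 1 / ((n : ℝ) + q)) ρ).toReal
        ≤ (powInt (1 - 1 / ((n : ℝ) + q)) ρ₀).toReal + (1 - 1 / ((n : ℝ) + q)) * (c - τ) := by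
  have hn0 : (0 : ℝ) ≤ n := n.cast_nonneg
  have hα : 0 < 1 - 1 / ((n : ℝ) + q) := by
    rw [sub_pos, div_lt_one (by linarith)]; linarith
  set α := 1 - 1 / ((n : ℝ) + q) with hαdef
  have hF : ∀ ρ : Measure (En n), IsProbabilityMeasure ρ → P1 ρ →
      Ffun n q ρ = ((-((powInt α ρ).toReal / α) : ℝ) : EReal) := by
    intro ρ hρ hρ1
    have hfin : powInt α ρ ≠ ∞ := powInt_ne_top (by linarith) ρ hρ1
    rw [Ffun_eq ρ hα, ← hαdef, EReal.coe_neg, ← EReal.coe_ennreal_toReal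
      (ENNReal.div_ne_top hfin (by simpa using hα)), ENNReal.toReal_div, ENNReal.toReal_ofReal hα.le]
  have hd1 : P1 (Measure.dirac (0 : En n)) := by
    unfold P1
    exact integrable_dirac (by simp)
  have hdT : Tcorr (Measure.dirac (0 : En n)) μ ≤ ((0 : ℝ) : EReal) := by
    have := Tcorr_le_of_norm_le (ρ := Measure.dirac (0 : En n)) hμ1 (r := 0)
      (by rw [ae_dirac_eq]; simp)
    simpa using this
  have h0 := hmin _ inferInstance hd1
  have hTtop : Tcorr ρ₀ μ ≠ ⊤ := by
    intro h
    rw [Jfun, Jfun, h, hF _ inferInstance hρ₀1, hF _ inferInstance hd1, EReal.coe_add_top] at h0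
    have h2 := h0.trans (add_le_add_right hdT _)
    rw [← EReal.coe_add] at h2
    exact absurd h2 (by simp)
  have hTbot := Tcorr_ne_bot hρ₀1 hμ1
  refine ⟨(Tcorr ρ₀ μ).toReal, by rw [EReal.coe_toReal hTtop hTbot], fun ρ hρ hρ1 c hc => ?_⟩
  have h1 := (hmin ρ hρ hρ1).trans (add_le_add_right hc (Ffun n q ρ))
  rw [Jfun, hF _ hρ hρ1, hF _ inferInstance hρ₀1, ← EReal.coe_toReal hTtop hTbot,
    ← EReal.coe_add, ← EReal.coe_add, EReal.coe_le_coe_iff] at h1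
  have h3 : (powInt α ρ).toReal / α ≤ (powInt α ρ₀).toReal / α + (c - (Tcorr ρ₀ μ).toReal) := by
    linarith
  have h4 := mul_le_mul_of_nonneg_left h3 hα.le
  rw [mul_add, mul_div_cancel₀ _ hα.ne', mul_div_cancel₀ _ hα.ne'] at h4
  exact h4

theorem rpow_add_mul_le_add_rpow {α a k b : ℝ} (hα0 : 0 ≤ α) (hα1 : α ≤ 1) (ha : 0 ≤ a)
    (hk : 0 ≤ k) (hb : a + k ≤ b) : a ^ α + α * b ^ (α - 1) * k ≤ (a + k) ^ α := by
  rcases hk.eq_or_lt with rfl | hk'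
  · simp
  have hs : 0 < a + k := by linarith
  have h1 : (1 + -(k / (a + k))) ^ α ≤ 1 + α * (-(k / (a + k))) := by
    refine rpow_one_add_le_one_add_mul_self ?_ hα0 hα1
    rw [neg_le_neg_iff, div_le_one hs]; linarith
  have h2 : 1 + -(k / (a + k)) = a / (a + k) := by field_simp; ring
  rw [h2, Real.div_rpow ha hs.le, div_le_iff₀ (by positivity)] at h1
  have h3 : (a + k) ^ (α - 1) = (a + k) ^ α / (a + k) := by
    rw [Real.rpow_sub hs, Real.rpow_one]
  have h4 : b ^ (α - 1) ≤ (a + k) ^ (α - 1) :=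
    Real.rpow_le_rpow_of_nonpos hs hb (by linarith)
  have h5 : α * b ^ (α - 1) * k ≤ α * ((a + k) ^ α / (a + k)) * k := by
    rw [← h3]; gcongr
  have h6 : (1 + α * -(k / (a + k))) * (a + k) ^ α
    = (a + k) ^ α - α * ((a + k) ^ α / (a + k)) * k := by field_simp; ring
  linarith

theorem ennreal_rpow_add_mul_le {α : ℝ} (hα0 : 0 < α) (hα1 : α ≤ 1) {a k : ℝ≥0∞} {b : ℝ}
    (hb : a + k ≤ ENNReal.ofReal b) (hb0 : 0 ≤ b) :
    a ^ α + ENNReal.ofReal (α * b ^ (α - 1)) * k ≤ (a + k) ^ α := by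
  have hs : a + k ≠ ∞ := ne_top_of_le_ne_top ENNReal.ofReal_ne_top hb
  have ha : a ≠ ∞ := ne_top_of_le_ne_top hs le_self_add
  have hk : k ≠ ∞ := ne_top_of_le_ne_top hs le_add_self
  lift a to NNReal using ha
  lift k to NNReal using hk
  rw [← ENNReal.ofReal_coe_nnreal, ← ENNReal.ofReal_coe_nnreal (p := k),
    ← ENNReal.ofReal_add a.coe_nonneg k.coe_nonneg] at *
  rw [ENNReal.ofReal_le_ofReal_iff hb0] at hb
  rw [ENNReal.ofReal_rpow_of_nonneg a.coe_nonneg hα0.le,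
    ENNReal.ofReal_rpow_of_nonneg (by positivity) hα0.le, ← ENNReal.ofReal_mul (by positivity),
    ← ENNReal.ofReal_add (Real.rpow_nonneg a.coe_nonneg _)
      (mul_nonneg (by positivity) k.coe_nonneg)]
  exact ENNReal.ofReal_le_ofReal
    (rpow_add_mul_le_add_rpow hα0.le hα1 a.coe_nonneg k.coe_nonneg hb)

/-- The density of the convolution of `s` with the uniform measure on the ball of radius `ε`. -/
def ballDensity {n : ℕ} (s : Measure (En n)) (ε : ℝ) (w : En n) : ℝ≥0∞ :=
  ∫⁻ x, (volume (Metric.ball (0 : En n) ε))⁻¹ *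
    (Metric.ball (0 : En n) ε).indicator 1 (w - x) ∂s

theorem measurable_ballDensity_aux {n : ℕ} (ε : ℝ) :
    Measurable (fun p : En n × En n => (volume (Metric.ball (0 : En n) ε))⁻¹ *
    (Metric.ball (0 : En n) ε).indicator (1 : En n → ℝ≥0∞) (p.2 - p.1)) :=
  (((measurable_one.indicator measurableSet_ball).comp
    (measurable_snd.sub measurable_fst))).const_mul _

theorem measurable_ballDensity {n : ℕ} (s : Measure (En n)) [SFinite s] (ε : ℝ) :
    Measurable (ballDensity s ε) :=
  (measurable_ballDensity_aux ε).lintegral_prod_left'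

theorem setLIntegral_ballDensity {n : ℕ} (s : Measure (En n)) [SFinite s] (ε : ℝ)
    (A : Set (En n)) :
    ∫⁻ w in A, ballDensity s ε w = ∫⁻ x, (volume (Metric.ball (0 : En n) ε))⁻¹ *
      volume (A ∩ Metric.ball x ε) ∂s := by
  unfold ballDensity
  rw [lintegral_lintegral_swap (f := fun w x : En n => (volume (Metric.ball (0 : En n) ε))⁻¹ *
    (Metric.ball (0 : En n) ε).indicator (1 : En n → ℝ≥0∞) (w - x))
    ((measurable_ballDensity_aux ε).comp measurable_swap).aemeasurable]
  refine lintegral_congr fun x => ?_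
  have : ∀ w : En n, (Metric.ball (0 : En n) ε).indicator (1 : En n → ℝ≥0∞) (w - x)
      = (Metric.ball x ε).indicator 1 w := by
    intro w
    simp [indicator, dist_eq_norm]
  simp_rw [this]
  rw [lintegral_const_mul _ (measurable_one.indicator measurableSet_ball),
    lintegral_indicator_one measurableSet_ball,
    Measure.restrict_apply measurableSet_ball, inter_comm]

theorem ballDensity_le {n : ℕ} (s : Measure (En n)) (ε : ℝ) (w : En n) (hs : s univ ≤ 1) :
    ballDensity s ε w ≤ (volume (Metric.ball (0 : En n) ε))⁻¹ := by
  calc ballDensity s ε w ≤ ∫⁻ _, (volume (Metric.ball (0 : En n) ε))⁻¹ ∂s := by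
        refine lintegral_mono fun x => ?_
        conv_rhs => rw [← mul_one (volume (Metric.ball (0 : En n) ε))⁻¹]
        gcongr
        exact indicator_le_self' (by simp) _
    _ = (volume (Metric.ball (0 : En n) ε))⁻¹ * s univ := by rw [lintegral_const]
    _ ≤ _ := mul_le_of_le_one_right' hs

theorem volume_ball_zero_pos_lt_top {n : ℕ} {ε : ℝ} (hε : 0 < ε) :
    volume (Metric.ball (0 : En n) ε) ≠ 0 ∧ volume (Metric.ball (0 : En n) ε) ≠ ∞ :=
  ⟨(Metric.measure_ball_pos volume _ hε).ne', measure_ball_lt_top.ne⟩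

theorem map_add_prod_uniform {n : ℕ} (s : Measure (En n)) [SFinite s] (ε : ℝ) :
    (s.prod ((volume (Metric.ball (0 : En n) ε))⁻¹ •
      volume.restrict (Metric.ball (0 : En n) ε))).map (fun p => p.1 + p.2)
      = volume.withDensity (ballDensity s ε) := by
  ext A hA
  have hm : Measurable (fun p : En n × En n => p.1 + p.2) := by fun_prop
  rw [withDensity_apply _ hA, setLIntegral_ballDensity s ε A, Measure.map_apply hm hA,
    Measure.prod_apply (hm hA)]
  refine lintegral_congr fun x => ?_
  rw [Measure.smul_apply, smul_eq_mul, Measure.restrict_apply (measurable_prodMk_left (hm hA)),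
    ← measure_preimage_add volume x (A ∩ Metric.ball x ε)]
  congr 2
  ext z
  simp [dist_eq_norm]

/-- A measure which cannot be improved by spreading has no singular part. -/
theorem absolutelyContinuous_of_powInt_le {n : ℕ} {N : ℝ} (hN : (n : ℝ) + 1 < N)
    {μ ρ : Measure (En n)} [IsProbabilityMeasure ρ]
    (hμ1 : P1 μ) (hρ1 : P1 ρ) {τ : ℝ} (hτ : Tcorr ρ μ ≤ τ)
    (hmin : ∀ ν : Measure (En n), IsProbabilityMeasure ν → P1 ν → ∀ c : ℝ, Tcorr ν μ ≤ c →
      (powInt (1 - 1 / N) ν).toReal ≤ (powInt (1 - 1 / N) ρ).toReal + (1 - 1 / N) * (c - τ)) :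
    ρ ≪ volume := by
  have hn0 : (0 : ℝ) ≤ n := n.cast_nonneg
  have hα : 0 < 1 - 1 / N := by rw [sub_pos, div_lt_one (by linarith)]; linarith
  have hN0 : 0 < N := by linarith
  have hα1 : 1 - 1 / N ≤ 1 := by rw [sub_le_self_iff]; positivity
  set α := 1 - 1 / N with hαdef
  rw [← Measure.singularPart_eq_zero]
  set s := ρ.singularPart volume with hs
  set a := ρ.rnDeriv volume with ha
  have ham : Measurable a := Measure.measurable_rnDeriv _ _
  have hdec : s + volume.withDensity a = ρ := Measure.singularPart_add_rnDeriv ρ volume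
  have hs1 : s univ ≤ 1 := by
    rw [← measure_univ (μ := ρ)]; exact Measure.singularPart_le _ _ _
  have ha1 : ∫⁻ x, a x ≤ 1 := by
    rw [← measure_univ (μ := ρ)]; exact Measure.lintegral_rnDeriv_le
  by_contra hs0
  have hm0 : s univ ≠ 0 := fun h => hs0 (Measure.measure_univ_eq_zero.1 h)
  set m := (s univ).toReal with hm
  have hm_pos : 0 < m := ENNReal.toReal_pos hm0 (measure_ne_top _ _)
  set M := ∫ y, ‖y‖ ∂μ
  have step : ∀ ε : ℝ, 0 < ε →
      ((volume (Metric.ball (0 : En n) ε)).toReal / 3) ^ (1 / N) * (m / 2) ≤ ε * M := by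
    intro ε hε
    obtain ⟨hV0, hVt⟩ := volume_ball_zero_pos_lt_top (n := n) hε
    set V := volume (Metric.ball (0 : En n) ε) with hV
    set v := V.toReal with hv
    have hv0 : 0 < v := ENNReal.toReal_pos hV0 hVt
    set k := ballDensity s ε with hk
    have hkm : Measurable k := measurable_ballDensity s ε
    set U : Measure (En n) := V⁻¹ • volume.restrict (Metric.ball (0 : En n) ε) with hU
    have hUp : IsProbabilityMeasure U := ⟨by simp [hU, ← hV, ENNReal.inv_mul_cancel hV0 hVt]⟩
    set π : Measure (En n × En n) := s.prod U + (volume.withDensity a).prod (Measure.dirac 0)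
      with hπ
    have hafin : IsFiniteMeasure (volume.withDensity a) :=
      isFiniteMeasure_withDensity (ne_top_of_le_ne_top ENNReal.one_ne_top ha1)
    have hπ1 : π.map Prod.fst = ρ := by
      rw [hπ, Measure.map_add _ _ measurable_fst, Measure.map_fst_prod, Measure.map_fst_prod,
        measure_univ, measure_univ, one_smul, one_smul, hdec]
    have hπp : IsProbabilityMeasure π := by
      refine ⟨?_⟩
      have : π.map Prod.fst univ = 1 := by rw [hπ1]; exact measure_univ
      rwa [Measure.map_apply measurable_fst MeasurableSet.univ, preimage_univ] at this
    have hy : ∀ᵐ y ∂(π.map Prod.snd), ‖y‖ ≤ ε := by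
      rw [hπ, Measure.map_add _ _ measurable_snd, Measure.map_snd_prod, Measure.map_snd_prod,
        ae_add_measure_iff]
      constructor
      · refine Measure.ae_smul_measure (Measure.ae_smul_measure ?_ _) _
        filter_upwards [ae_restrict_mem measurableSet_ball] with y hy
        exact (mem_ball_zero_iff.1 hy).le
      · refine Measure.ae_smul_measure ?_ _
        rw [ae_dirac_eq]
        simpa using hε.le
    have hY1 : P1 (π.map Prod.snd) := by
      have : IsProbabilityMeasure (π.map Prod.snd) :=
        Measure.isProbabilityMeasure_map measurable_snd.aemeasurable
      exact (integrable_const ε).mono' (by fun_prop) (by simpa using hy)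
    have hadd : Measurable (fun p : En n × En n => p.1 + p.2) := by fun_prop
    have hlaw : π.map (fun p => p.1 + p.2) = volume.withDensity (a + k) := by
      rw [hπ, Measure.map_add _ _ hadd, map_add_prod_uniform, withDensity_add_left ham, add_comm]
      congr 1
      rw [Measure.prod_dirac, Measure.map_map hadd (by fun_prop)]
      simp [Function.comp_def]
    have hT := Tcorr_map_add_le π (X := Prod.fst) (Y := Prod.snd) measurable_fst measurable_snd
      hμ1 (hπ1 ▸ hρ1) hY1 zero_le_one zero_le_one (hπ1 ▸ hτ) (Tcorr_le_of_norm_le hμ1 hy)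
    simp only [one_smul, one_mul] at hT
    have hprob : IsProbabilityMeasure (π.map (fun p => p.1 + p.2)) :=
      Measure.isProbabilityMeasure_map hadd.aemeasurable
    have hP1 : P1 (π.map (fun p : En n × En n => p.1 + p.2)) := by
      unfold P1 at *
      rw [← hπ1] at hρ1
      rw [integrable_map_measure (by fun_prop) (by fun_prop)] at *
      exact (hρ1.add hY1).mono' (by fun_prop) (ae_of_all _ fun p => by
        simpa using norm_add_le p.1 p.2)
    have hineq := hmin _ hprob hP1 _ hT
    have hle : powInt α ρ + ENNReal.ofReal (α * (3 / v) ^ (α - 1) * (m / 2))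
        ≤ powInt α (π.map (fun p => p.1 + p.2)) := by
      have e1 : powInt α (π.map (fun p => p.1 + p.2)) = ∫⁻ x, (a x + k x) ^ α := by
        rw [hlaw]
        refine lintegral_congr_ae ?_
        filter_upwards [Measure.rnDeriv_withDensity volume (ham.add hkm)] with x hx
        rw [hx, Pi.add_apply]
      set A : Set (En n) := {x | ENNReal.ofReal (2 / v) < a x} with hA
      have hAm : MeasurableSet A := measurableSet_lt measurable_const ham
      have hVA : volume A ≤ V / 2 := by
        have h1 := mul_meas_ge_le_lintegral (μ := volume) ham (ENNReal.ofReal (2 / v))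
        have h2 : ENNReal.ofReal (2 / v) * volume A ≤ 1 :=
          (le_trans (by gcongr; exact fun x (hx : _ < _) => show _ ≤ a x from hx.le) h1).trans ha1
        rw [ENNReal.ofReal_div_of_pos hv0, hv, ENNReal.ofReal_toReal hVt] at h2
        rw [ENNReal.le_div_iff_mul_le (by simp) (by simp), mul_comm]
        have h3 : V * (ENNReal.ofReal 2 / V * volume A) ≤ V * 1 := by gcongr
        rwa [← mul_assoc, ENNReal.mul_div_cancel hV0 hVt, mul_one, ENNReal.ofReal_ofNat] at h3
      have hkA : ∫⁻ x in A, k x ≤ s univ / 2 := by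
        rw [hk, setLIntegral_ballDensity s ε A]
        calc ∫⁻ x, V⁻¹ * volume (A ∩ Metric.ball x ε) ∂s ≤ ∫⁻ x, V⁻¹ * (V / 2) ∂s := by
              refine lintegral_mono fun x => ?_
              gcongr
              exact (measure_mono inter_subset_left).trans hVA
          _ = s univ / 2 := by
              rw [lintegral_const, ← mul_div_assoc, ENNReal.inv_mul_cancel hV0 hVt, mul_comm,
                mul_one_div]
      have hku : ∫⁻ x, k x = s univ := by
        rw [← setLIntegral_univ, hk, setLIntegral_ballDensity s ε univ]
        simp only [univ_inter]
        have : ∀ x : En n, volume (Metric.ball x ε) = V := fun x => by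
          rw [hV, Measure.addHaar_ball_center]
        simp_rw [this]
        rw [lintegral_const, ENNReal.inv_mul_cancel hV0 hVt, one_mul]
      have hkAc : ENNReal.ofReal (m / 2) ≤ ∫⁻ x in Aᶜ, k x := by
        have h1 : (∫⁻ x in A, k x) + ∫⁻ x in Aᶜ, k x = s univ := by
          rw [lintegral_add_compl _ hAm, hku]
        have h2 : s univ / 2 + ∫⁻ x in Aᶜ, k x ≥ s univ / 2 + s univ / 2 := by
          have h3 := add_le_add hkA (le_refl (∫⁻ x in Aᶜ, k x))
          rw [h1] at h3
          rwa [ENNReal.add_halves]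
        rw [ENNReal.ofReal_div_of_pos two_pos, hm, ENNReal.ofReal_toReal (measure_ne_top _ _),
          ENNReal.ofReal_ofNat]
        exact (ENNReal.add_le_add_iff_left
          (ENNReal.div_ne_top (measure_ne_top _ _) two_ne_zero)).1 h2
      rw [e1]
      calc powInt α ρ + ENNReal.ofReal (α * (3 / v) ^ (α - 1) * (m / 2))
          ≤ (∫⁻ x, a x ^ α) + ENNReal.ofReal (α * (3 / v) ^ (α - 1)) * ∫⁻ x in Aᶜ, k x := by
            rw [ENNReal.ofReal_mul (by positivity)]
            exact add_le_add le_rfl (mul_le_mul_right hkAc _)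
        _ = ∫⁻ x, (a x ^ α
              + Aᶜ.indicator (fun x => ENNReal.ofReal (α * (3 / v) ^ (α - 1)) * k x) x) := by
            rw [lintegral_add_left (ham.pow_const α), lintegral_indicator hAm.compl,
              lintegral_const_mul _ hkm]
        _ ≤ _ := by
            refine lintegral_mono fun x => ?_
            by_cases hx : x ∈ A
            · rw [indicator_of_notMem (by simpa using hx), add_zero]
              gcongr
              exact le_self_add
            · rw [indicator_of_mem (by simpa using hx)]
              refine ennreal_rpow_add_mul_le hα hα1 ?_ (by positivity)
              have h1 : a x ≤ ENNReal.ofReal (2 / v) := not_lt.1 hx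
              have h2 : k x ≤ ENNReal.ofReal (1 / v) := by
                refine (ballDensity_le s ε x hs1).trans (le_of_eq ?_)
                rw [ENNReal.ofReal_div_of_pos hv0, hv, ENNReal.ofReal_toReal hVt,
                  ENNReal.ofReal_one, one_div]
              refine (add_le_add h1 h2).trans (le_of_eq ?_)
              rw [← ENNReal.ofReal_add (by positivity) (by positivity)]
              congr 1; ring
    have hfin := powInt_ne_top hN _ hP1
    have hfin' := powInt_ne_top hN _ hρ1
    have hle2 := (ENNReal.toReal_le_toReal
      (ENNReal.add_ne_top.2 ⟨hfin', ENNReal.ofReal_ne_top⟩) hfin).2 hle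
    rw [ENNReal.toReal_add hfin' ENNReal.ofReal_ne_top,
      ENNReal.toReal_ofReal (by positivity)] at hle2
    have hfinal : α * (3 / v) ^ (α - 1) * (m / 2) ≤ α * (ε * M) := by
      have : τ + ε * M - τ = ε * M := by ring
      rw [this] at hineq
      linarith
    rw [mul_assoc, mul_le_mul_iff_right₀ hα] at hfinal
    refine le_of_eq_of_le ?_ hfinal
    congr 1
    rw [show α - 1 = -(1 / N) by rw [hαdef]; ring, Real.rpow_neg (by positivity),
      ← Real.inv_rpow (by positivity), inv_div]
  set v₁ := (volume (Metric.ball (0 : En n) 1)).toReal with hv₁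
  have hv₁0 : 0 < v₁ := ENNReal.toReal_pos (volume_ball_zero_pos_lt_top one_pos).1
    (volume_ball_zero_pos_lt_top one_pos).2
  set K := (v₁ / 3) ^ (1 / N) * (m / 2) with hK
  have hK0 : 0 < K := by positivity
  have step2 : ∀ ε : ℝ, 0 < ε → K ≤ ε ^ (1 - n / N) * M := by
    intro ε hε
    have h1 := step ε hε
    rw [Measure.addHaar_ball_of_pos _ _ hε, finrank_euclideanSpace_fin, ENNReal.toReal_mul,
      ENNReal.toReal_ofReal (by positivity), ← hv₁, mul_div_assoc,
      Real.mul_rpow (by positivity) (by positivity), mul_assoc, ← hK, ← Real.rpow_natCast,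
      ← Real.rpow_mul hε.le, mul_one_div] at h1
    rw [Real.rpow_sub hε, Real.rpow_one, div_mul_eq_mul_div, le_div_iff₀ (by positivity), mul_comm]
    exact h1
  have hexp : 0 < 1 - (n : ℝ) / N := by
    rw [sub_pos, div_lt_one (by linarith)]; linarith
  have hlim : Tendsto (fun ε : ℝ => ε ^ (1 - (n : ℝ) / N) * M) (𝓝[>] 0) (𝓝 0) := by
    have : ContinuousAt (fun ε : ℝ => ε ^ (1 - (n : ℝ) / N) * M) 0 :=
      (Real.continuousAt_rpow_const _ _ (Or.inr hexp.le)).mul continuousAt_const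
    have h2 := this.tendsto
    simp only [Real.zero_rpow hexp.ne', zero_mul] at h2
    exact h2.mono_left nhdsWithin_le_nhds
  have := ge_of_tendsto hlim (eventually_mem_nhdsWithin.mono fun ε hε => step2 ε hε)
  linarith

theorem powInt_withDensity {n : ℕ} (α : ℝ) {h : En n → ℝ≥0∞} (hh : Measurable h) :
    powInt α (volume.withDensity h) = ∫⁻ x, h x ^ α := by
  refine lintegral_congr_ae ?_
  filter_upwards [Measure.rnDeriv_withDensity volume hh] with x hx
  rw [hx]

theorem map_interp_prod_absolutelyContinuous {n : ℕ} {ρ : Measure (En n)} [SFinite ρ]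
    (hac : ρ ≪ volume) {t : ℝ} (ht1 : t < 1) :
    (ρ.prod ρ).map (fun p => (1 - t) • p.1 + t • p.2) ≪ volume := by
  have hm : Measurable (fun p : En n × En n => (1 - t) • p.1 + t • p.2) := by fun_prop
  refine Measure.AbsolutelyContinuous.mk fun A hA hA0 => ?_
  rw [Measure.map_apply hm hA, Measure.prod_apply_symm (hm hA)]
  simp only [lintegral_eq_zero_iff (measurable_measure_prodMk_right (hm hA))]
  refine ae_of_all _ fun y => hac ?_
  have : (fun x : En n => (x, y)) ⁻¹' ((fun p : En n × En n => (1 - t) • p.1 + t • p.2) ⁻¹' A)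
      = ((1 - t) • ·) ⁻¹' ((fun x => x + t • y) ⁻¹' A) := rfl
  rw [this, Measure.addHaar_preimage_smul _ (by linarith), measure_preimage_add_right, hA0,
    mul_zero]

/-- The law of a convex combination of two independent copies of a maximizer of `powInt` does not
charge sets which the maximizer does not charge. -/
theorem map_interp_prod_absolutelyContinuous_self {n : ℕ} {N : ℝ} (hN : (n : ℝ) + 1 < N)
    {μ ρ : Measure (En n)} [IsProbabilityMeasure ρ]
    (hμ1 : P1 μ) (hρ1 : P1 ρ) {τ : ℝ} (hτ : Tcorr ρ μ ≤ τ)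
    (hmin : ∀ ν : Measure (En n), IsProbabilityMeasure ν → P1 ν → ∀ c : ℝ, Tcorr ν μ ≤ c →
      (powInt (1 - 1 / N) ν).toReal ≤ (powInt (1 - 1 / N) ρ).toReal + (1 - 1 / N) * (c - τ))
    {t : ℝ} (ht0 : 0 < t) (ht1 : t < 1) :
    (ρ.prod ρ).map (fun p => (1 - t) • p.1 + t • p.2) ≪ ρ := by
  have hac := absolutelyContinuous_of_powInt_le hN hμ1 hρ1 hτ hmin
  have hn0 : (0 : ℝ) ≤ n := n.cast_nonneg
  have hN0 : 0 < N := by linarith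
  have hα : 0 < 1 - 1 / N := by rw [sub_pos, div_lt_one (by linarith)]; linarith
  have hα1 : 1 - 1 / N < 1 := by rw [sub_lt_self_iff]; positivity
  set α := 1 - 1 / N with hαdef
  have hm : Measurable (fun p : En n × En n => (1 - t) • p.1 + t • p.2) := by fun_prop
  set M := (ρ.prod ρ).map (fun p => (1 - t) • p.1 + t • p.2) with hM
  have hMp : IsProbabilityMeasure M := Measure.isProbabilityMeasure_map hm.aemeasurable
  have hMac : M ≪ volume := map_interp_prod_absolutelyContinuous hac ht1
  set f := ρ.rnDeriv volume
  set g := M.rnDeriv volume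
  have hf : Measurable f := Measure.measurable_rnDeriv _ _
  have hg : Measurable g := Measure.measurable_rnDeriv _ _
  have hρf : volume.withDensity f = ρ := Measure.withDensity_rnDeriv_eq _ _ hac
  have hMg : volume.withDensity g = M := Measure.withDensity_rnDeriv_eq _ _ hMac
  set Z : Set (En n) := {x | f x = 0} with hZ
  have hZm : MeasurableSet Z := hf (measurableSet_singleton 0)
  set K := ∫⁻ x in Z, g x ^ α with hK
  set P := (powInt α ρ).toReal with hP
  have hPt := powInt_ne_top hN _ hρ1
  have step : ∀ ε : ℝ, 0 < ε → ε < 1 → K ≤ ENNReal.ofReal (ε ^ (1 - α) * P) := by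
    intro ε hε hε1
    have hsum : ENNReal.ofReal (1 - ε) + ENNReal.ofReal ε = 1 := by
      rw [← ENNReal.ofReal_add (by linarith) hε.le]; simp
    have hdiag : Measurable (fun x : En n => (x, x)) := by fun_prop
    set π : Measure (En n × En n) := ENNReal.ofReal (1 - ε) • ρ.map (fun x => (x, x))
      + ENNReal.ofReal ε • ρ.prod ρ with hπ
    have hπ1 : π.map Prod.fst = ρ := by
      rw [hπ, Measure.map_add _ _ measurable_fst, Measure.map_smul, Measure.map_smul,
        Measure.map_map measurable_fst hdiag, Measure.map_fst_prod, measure_univ, one_smul]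
      simp only [Function.comp_def, Measure.map_id']
      rw [← add_smul, hsum, one_smul]
    have hπ2 : π.map Prod.snd = ρ := by
      rw [hπ, Measure.map_add _ _ measurable_snd, Measure.map_smul, Measure.map_smul,
        Measure.map_map measurable_snd hdiag, Measure.map_snd_prod, measure_univ, one_smul]
      simp only [Function.comp_def, Measure.map_id']
      rw [← add_smul, hsum, one_smul]
    have hπp : IsProbabilityMeasure π := by
      refine ⟨?_⟩
      have : π.map Prod.fst univ = 1 := by rw [hπ1]; exact measure_univ
      rwa [Measure.map_apply measurable_fst MeasurableSet.univ, preimage_univ] at this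
    have hlaw : π.map (fun p => (1 - t) • p.1 + t • p.2)
        = volume.withDensity (fun x => ENNReal.ofReal (1 - ε) * f x + ENNReal.ofReal ε * g x) := by
      rw [hπ, Measure.map_add _ _ hm, Measure.map_smul, Measure.map_smul, Measure.map_map hm hdiag,
        ← hM, ← hMg]
      simp only [Function.comp_def, ← add_smul, sub_add_cancel, one_smul, Measure.map_id']
      nth_rw 1 [← hρf]
      rw [← withDensity_smul _ hf, ← withDensity_smul _ hg,
        ← withDensity_add_left (hf.const_smul _)]
      rfl
    have hT := Tcorr_map_add_le π (X := Prod.fst) (Y := Prod.snd) measurable_fst measurable_snd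
      hμ1 (hπ1 ▸ hρ1) (hπ2 ▸ hρ1) (a := 1 - t) (b := t) (by linarith) ht0.le
      (hπ1 ▸ hτ) (hπ2 ▸ hτ)
    have hprob : IsProbabilityMeasure (π.map (fun p => (1 - t) • p.1 + t • p.2)) :=
      Measure.isProbabilityMeasure_map hm.aemeasurable
    have hP1 : P1 (π.map (fun p : En n × En n => (1 - t) • p.1 + t • p.2)) := by
      have h1 : P1 (π.map Prod.fst) := hπ1 ▸ hρ1
      have h2 : P1 (π.map Prod.snd) := hπ2 ▸ hρ1
      unfold P1 at h1 h2 ⊢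
      rw [integrable_map_measure (by fun_prop) (by fun_prop)] at *
      exact (h1.add h2).mono' (by fun_prop) (ae_of_all _ fun p => by
        simp only [Function.comp_def, norm_norm, Pi.add_apply]
        refine (norm_add_le _ _).trans ?_
        rw [norm_smul, norm_smul, Real.norm_of_nonneg (by linarith), Real.norm_of_nonneg ht0.le]
        nlinarith [norm_nonneg p.1, norm_nonneg p.2])
    have hineq := hmin _ hprob hP1 _ hT
    have hfin := powInt_ne_top hN _ hP1
    have hle : ENNReal.ofReal ((1 - ε) ^ α) * powInt α ρ + ENNReal.ofReal (ε ^ α) * K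
        ≤ powInt α (π.map (fun p => (1 - t) • p.1 + t • p.2)) := by
      rw [hlaw, powInt_withDensity _ (by fun_prop), hK, ← lintegral_indicator hZm,
        ← lintegral_const_mul _ ((hg.pow_const α).indicator hZm), powInt,
        ← lintegral_const_mul _ (hf.pow_const α), ← lintegral_add_left (by fun_prop)]
      refine lintegral_mono fun x => ?_
      rw [← ENNReal.ofReal_rpow_of_nonneg (by linarith) hα.le,
        ← ENNReal.ofReal_rpow_of_nonneg hε.le hα.le]
      by_cases hx : x ∈ Z
      · have hx' : f x = 0 := hx
        simp only [indicator_of_mem hx]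
        rw [hx', ENNReal.zero_rpow_of_pos hα, mul_zero,
          mul_zero, zero_add, zero_add, ENNReal.mul_rpow_of_nonneg _ _ hα.le]
      · simp only [indicator_of_notMem hx, mul_zero, add_zero]
        rw [← ENNReal.mul_rpow_of_nonneg _ _ hα.le]
        gcongr
        exact le_self_add
    have hle2 : ENNReal.ofReal ((1 - ε) ^ α) * powInt α ρ + ENNReal.ofReal (ε ^ α) * K
        ≤ ENNReal.ofReal P := by
      refine hle.trans ?_
      rw [← ENNReal.ofReal_toReal hfin]
      refine ENNReal.ofReal_le_ofReal (hineq.trans (le_of_eq ?_))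
      rw [hP]; ring
    rw [← ENNReal.ofReal_toReal hPt, ← hP, ← ENNReal.ofReal_mul (by positivity)] at hle2
    have hKt : K ≠ ∞ := by
      intro h
      rw [h, ENNReal.mul_top (by simp; positivity), add_top] at hle2
      exact ENNReal.ofReal_ne_top (top_le_iff.1 hle2)
    have hP0 : 0 ≤ P := ENNReal.toReal_nonneg
    rw [← ENNReal.ofReal_toReal hKt, ← ENNReal.ofReal_mul (by positivity),
      ← ENNReal.ofReal_add (by positivity) (by positivity), ENNReal.ofReal_le_ofReal_iff hP0] at hle2
    rw [← ENNReal.ofReal_toReal hKt]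
    refine ENNReal.ofReal_le_ofReal ?_
    have h1 : 1 - ε ≤ (1 - ε) ^ α := by
      conv_lhs => rw [← Real.rpow_one (1 - ε)]
      exact Real.rpow_le_rpow_of_exponent_ge (by linarith) (by linarith) hα1.le
    have h2 : ε ^ α * K.toReal ≤ ε * P := by nlinarith
    rw [Real.rpow_sub hε, Real.rpow_one, div_mul_eq_mul_div, le_div_iff₀ (by positivity), mul_comm]
    exact h2
  have hK0 : K = 0 := by
    have hlim : Tendsto (fun ε : ℝ => ENNReal.ofReal (ε ^ (1 - α) * P)) (𝓝[>] 0) (𝓝 0) := by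
      have : ContinuousAt (fun ε : ℝ => ENNReal.ofReal (ε ^ (1 - α) * P)) 0 :=
        ENNReal.continuous_ofReal.continuousAt.comp
          ((Real.continuousAt_rpow_const _ _ (Or.inr (by linarith))).mul continuousAt_const)
      have h2 := this.tendsto
      simp only [Real.zero_rpow (sub_pos.2 hα1).ne', zero_mul, ENNReal.ofReal_zero] at h2
      exact h2.mono_left nhdsWithin_le_nhds
    refine le_antisymm (ge_of_tendsto hlim ?_) bot_le
    filter_upwards [Ioo_mem_nhdsGT (zero_lt_one' ℝ)] with ε hε using step ε hε.1 hε.2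
  have hMZ : M Z = 0 := by
    rw [← hMg, withDensity_apply _ hZm]
    rw [hK, lintegral_eq_zero_iff (hg.pow_const α)] at hK0
    rw [lintegral_eq_zero_iff hg]
    filter_upwards [hK0] with x hx
    exact (ENNReal.rpow_eq_zero_iff_of_pos hα).1 hx
  refine Measure.AbsolutelyContinuous.mk fun A hA hA0 => ?_
  have h1 : volume (A ∩ Zᶜ) = 0 := by
    rw [← hρf, withDensity_apply _ hA, lintegral_eq_zero_iff hf, EventuallyEq,
      ae_restrict_iff' hA] at hA0
    refine measure_mono_null ?_ hA0
    intro x hx h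
    exact hx.2 (h hx.1)
  refine measure_mono_null (t := Z ∪ (A ∩ Zᶜ)) ?_ (measure_union_null hMZ (hMac h1))
  intro x hx
  by_cases h : x ∈ Z
  · exact Or.inl h
  · exact Or.inr ⟨hx, h⟩

section Quantile

open ProbabilityTheory

/-- The quantile function of a probability measure on the line, extended by `0` outside
`(0, 1)`. -/
def quantile (ν : Measure ℝ) (u : ℝ) : ℝ :=
  open scoped Classical in if u ∈ Ioo (0 : ℝ) 1 then sInf {x | u ≤ cdf ν x} else 0

theorem quantile_le_iff (ν : Measure ℝ) {u : ℝ} (hu : u ∈ Ioo (0 : ℝ) 1) (x : ℝ) :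
    quantile ν u ≤ x ↔ u ≤ cdf ν x := by
  rw [quantile, if_pos hu]
  have hbdd : BddBelow {x | u ≤ cdf ν x} := by
    obtain ⟨a, ha⟩ := ((tendsto_cdf_atBot ν).eventually (gt_mem_nhds hu.1)).exists
    refine ⟨a, fun y hy => ?_⟩
    by_contra h
    exact absurd (hy.trans ((cdf ν).mono (not_le.1 h).le)) (not_le.2 ha)
  have hne : {x | u ≤ cdf ν x}.Nonempty := by
    obtain ⟨a, ha⟩ := ((tendsto_cdf_atTop ν).eventually (lt_mem_nhds hu.2)).exists
    exact ⟨a, ha.le⟩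
  refine ⟨fun h => ?_, fun h => csInf_le hbdd h⟩
  have hr : Tendsto (cdf ν) (𝓝[>] x) (𝓝 (cdf ν x)) :=
    ((cdf ν).right_continuous x).mono_left (nhdsWithin_mono _ Ioi_subset_Ici_self)
  refine ge_of_tendsto hr ?_
  filter_upwards [self_mem_nhdsWithin] with y hy
  obtain ⟨s, hs, hsy⟩ := (csInf_lt_iff hbdd hne).1 (h.trans_lt hy)
  exact le_trans hs ((cdf ν).mono hsy.le)

theorem measurable_quantile {Ω : Type*} [MeasurableSpace Ω] {ν : Ω → Measure ℝ}
    (h : ∀ x, Measurable fun ω => cdf (ν ω) x) :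
    Measurable (fun p : Ω × ℝ => quantile (ν p.1) p.2) := by
  refine measurable_of_Iic fun x => ?_
  have : (fun p : Ω × ℝ => quantile (ν p.1) p.2) ⁻¹' Iic x
      = {p | p.2 ∈ Ioo (0 : ℝ) 1} ∩ {p | p.2 ≤ cdf (ν p.1) x}
        ∪ {p | p.2 ∈ Ioo (0 : ℝ) 1}ᶜ ∩ {_p | 0 ≤ x} := by
    ext p
    by_cases hp : p.2 ∈ Ioo (0 : ℝ) 1
    · have := quantile_le_iff (ν p.1) hp x
      simp only [mem_preimage, mem_Iic, this, mem_union, mem_inter_iff, mem_ofPred_eq, hp,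
        mem_compl_iff, true_and, not_true, false_and, or_false]
    · simp only [mem_preimage, mem_Iic, quantile, hp, if_false, mem_union, mem_inter_iff,
        mem_ofPred_eq, mem_compl_iff, false_and, not_false_iff, true_and, false_or]
  rw [this]
  have h1 : MeasurableSet {p : Ω × ℝ | p.2 ∈ Ioo (0 : ℝ) 1} := measurable_snd measurableSet_Ioo
  exact (h1.inter (measurableSet_le measurable_snd ((h x).comp measurable_fst))).union
    (h1.compl.inter (MeasurableSet.const _))

theorem measurable_quantile_right (ν : Measure ℝ) : Measurable (quantile ν) :=
  (measurable_quantile (Ω := Unit) (ν := fun _ => ν) fun _ => measurable_const).comp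
    (measurable_const.prodMk measurable_id : Measurable fun u : ℝ => ((), u))

theorem map_quantile (ν : Measure ℝ) [IsProbabilityMeasure ν] :
    (volume.restrict (Ioo (0 : ℝ) 1)).map (quantile ν) = ν := by
  refine (Measure.ext_of_Iic _ _ fun x => ?_).symm
  have hm := measurable_quantile_right ν
  rw [Measure.map_apply hm measurableSet_Iic,
    Measure.restrict_apply (hm measurableSet_Iic), ← ofReal_cdf]
  have : quantile ν ⁻¹' Iic x ∩ Ioo (0 : ℝ) 1 = Ioo 0 1 ∩ Iic (cdf ν x) := by
    ext u
    by_cases hu : u ∈ Ioo (0 : ℝ) 1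
    · have := quantile_le_iff ν hu x
      simp only [mem_inter_iff, mem_preimage, mem_Iic, this, hu, and_true, true_and]
    · simp only [mem_inter_iff, hu, and_false, false_and]
  rw [this]
  refine le_antisymm ?_ ?_
  · calc ENNReal.ofReal (cdf ν x) = volume (Ioo 0 (cdf ν x)) := by simp
      _ ≤ volume (Ioo 0 1 ∩ Iic (cdf ν x)) :=
        measure_mono fun u hu => ⟨⟨hu.1, hu.2.trans_le (cdf_le_one ν x)⟩, hu.2.le⟩
  · calc volume (Ioo 0 1 ∩ Iic (cdf ν x)) ≤ volume (Ioc 0 (cdf ν x)) :=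
          measure_mono fun u hu => ⟨hu.1.1, hu.2⟩
      _ = _ := by simp

theorem cdf_quantile {ν : Measure ℝ} [IsProbabilityMeasure ν] (hν : ν ≪ volume) {u : ℝ}
    (hu : u ∈ Ioo (0 : ℝ) 1) : cdf ν (quantile ν u) = u := by
  refine le_antisymm ?_ ((quantile_le_iff ν hu _).1 le_rfl)
  have h0 : ν {quantile ν u} = 0 := hν (by simp)
  rw [← measure_cdf ν, StieltjesFunction.measure_singleton, measure_cdf,
    ENNReal.ofReal_eq_zero, sub_nonpos] at h0
  refine h0.trans (le_of_tendsto ((cdf ν).mono.tendsto_leftLim _) ?_)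
  filter_upwards [self_mem_nhdsWithin] with y hy
  by_contra h
  exact absurd ((quantile_le_iff ν hu y).2 (not_le.1 h).le) (not_le.2 hy)

theorem strictMonoOn_quantile {ν : Measure ℝ} [IsProbabilityMeasure ν] (hν : ν ≪ volume) :
    StrictMonoOn (quantile ν) (Ioo 0 1) := by
  intro u hu v hv huv
  by_contra h
  have := (cdf ν).mono (not_lt.1 h)
  rw [cdf_quantile hν hu, cdf_quantile hν hv] at this
  exact absurd this (not_le.2 huv)

variable {p : ℝ → ℝ≥0∞}

theorem isProbabilityMeasure_withDensity_of_lintegral {X : Type*} [MeasurableSpace X]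
    {m : Measure X} {f : X → ℝ≥0∞} (h : ∫⁻ x, f x ∂m = 1) :
    IsProbabilityMeasure (m.withDensity f) :=
  ⟨by rw [withDensity_apply _ MeasurableSet.univ, setLIntegral_univ, h]⟩

theorem ae_pos_and_lt_top_withDensity {X : Type*} [MeasurableSpace X]
    {m : Measure X} {f : X → ℝ≥0∞} (hf : Measurable f) (h : ∫⁻ x, f x ∂m = 1) :
    ∀ᵐ x ∂(m.withDensity f), f x ≠ 0 ∧ f x ≠ ∞ := by
  have h1 : ∀ᵐ x ∂m, f x ≠ ∞ :=
    (ae_lt_top hf (by rw [h]; exact ENNReal.one_ne_top)).mono fun x hx => hx.ne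
  rw [ae_withDensity_iff hf]
  filter_upwards [h1] with x hx h0 using ⟨h0, hx⟩

theorem lintegral_quantile (hp : Measurable p) (hp1 : ∫⁻ x, p x = 1) {g : ℝ → ℝ≥0∞}
    (hg : Measurable g) :
    ∫⁻ u in Ioo (0 : ℝ) 1, g (quantile (volume.withDensity p) u) = ∫⁻ x, p x * g x := by
  have := isProbabilityMeasure_withDensity_of_lintegral hp1
  rw [← lintegral_map hg (measurable_quantile_right _), map_quantile,
    lintegral_withDensity_eq_lintegral_mul _ hp hg]
  rfl

theorem ae_quantile (hp1 : ∫⁻ x, p x = 1) {P : ℝ → Prop}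
    (h : ∀ᵐ x ∂(volume.withDensity p), P x) :
    ∀ᵐ u ∂(volume.restrict (Ioo (0 : ℝ) 1)), P (quantile (volume.withDensity p) u) := by
  have := isProbabilityMeasure_withDensity_of_lintegral hp1
  rw [← map_quantile (volume.withDensity p)] at h
  exact ae_of_ae_map (measurable_quantile_right _).aemeasurable h

theorem ae_hasDerivAt_quantile (hp : Measurable p) (hp1 : ∫⁻ x, p x = 1) :
    ∀ᵐ u ∂(volume.restrict (Ioo (0 : ℝ) 1)),
      (p (quantile (volume.withDensity p) u) ≠ 0 ∧ p (quantile (volume.withDensity p) u) ≠ ∞) ∧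
      HasDerivAt (quantile (volume.withDensity p))
        (p (quantile (volume.withDensity p) u)).toReal⁻¹ u := by
  have := isProbabilityMeasure_withDensity_of_lintegral hp1
  set ν := volume.withDensity p with hν
  have hac : ν ≪ volume := withDensity_absolutelyContinuous _ _
  have h1 : ∀ᵐ x ∂ν, HasDerivAt (cdf ν) (p x).toReal x := by
    refine hac.ae_le ?_
    filter_upwards [(cdf ν).ae_hasDerivAt, Measure.rnDeriv_withDensity volume hp] with x hx hx2
    rwa [measure_cdf, hν, hx2] at hx
  have h2 := (strictMonoOn_quantile hac).monotoneOn.ae_differentiableWithinAt_of_mem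
  filter_upwards [ae_quantile hp1 h1, ae_quantile hp1 (ae_pos_and_lt_top_withDensity hp hp1),
    ae_restrict_of_ae h2, ae_restrict_mem measurableSet_Ioo] with u hu1 hu2 hu3 hu
  refine ⟨hu2, HasDerivAt.of_local_left_inverse ?_ hu1 (ENNReal.toReal_ne_zero.2 hu2) ?_⟩
  · exact ((hu3 hu).differentiableAt (Ioo_mem_nhds hu.1 hu.2)).continuousAt
  · filter_upwards [Ioo_mem_nhds hu.1 hu.2] with y hy using cdf_quantile hac hy

/-- Change of variables for the midpoint of two monotone rearrangements. -/
theorem lintegral_midpoint_quantile_le {p₀ p₁ : ℝ → ℝ≥0∞} (hp₀ : Measurable p₀)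
    (hp₁ : Measurable p₁) (h₀ : ∫⁻ x, p₀ x = 1) (h₁ : ∫⁻ x, p₁ x = 1) (g : ℝ → ℝ≥0∞) :
    ∫⁻ u in Ioo (0 : ℝ) 1,
      ((p₀ (quantile (volume.withDensity p₀) u))⁻¹ +
        (p₁ (quantile (volume.withDensity p₁) u))⁻¹) / 2 *
      g ((quantile (volume.withDensity p₀) u + quantile (volume.withDensity p₁) u) / 2)
      ≤ ∫⁻ x, g x := by
  have := isProbabilityMeasure_withDensity_of_lintegral h₀
  have := isProbabilityMeasure_withDensity_of_lintegral h₁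
  have hac₀ : volume.withDensity p₀ ≪ volume := withDensity_absolutelyContinuous _ _
  have hac₁ : volume.withDensity p₁ ≪ volume := withDensity_absolutelyContinuous _ _
  have hgood := (ae_hasDerivAt_quantile hp₀ h₀).and (ae_hasDerivAt_quantile hp₁ h₁)
  set s₀ := quantile (volume.withDensity p₀)
  set s₁ := quantile (volume.withDensity p₁)
  obtain ⟨t, hst, ht, ht0⟩ := exists_measurable_superset_of_null (ae_iff.1 hgood)
  have hr : (volume.restrict (Ioo (0 : ℝ) 1)).restrict tᶜ = volume.restrict (Ioo (0 : ℝ) 1) :=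
    Measure.restrict_eq_self_of_ae_mem (measure_eq_zero_iff_ae_notMem.1 ht0)
  rw [Measure.restrict_restrict ht.compl] at hr
  rw [← hr]
  set S := tᶜ ∩ Ioo (0 : ℝ) 1
  have hS : MeasurableSet S := ht.compl.inter measurableSet_Ioo
  have hgoodS : ∀ u ∈ S, ((p₀ (s₀ u) ≠ 0 ∧ p₀ (s₀ u) ≠ ∞) ∧
      HasDerivAt s₀ (p₀ (s₀ u)).toReal⁻¹ u) ∧ (p₁ (s₁ u) ≠ 0 ∧ p₁ (s₁ u) ≠ ∞) ∧
      HasDerivAt s₁ (p₁ (s₁ u)).toReal⁻¹ u := by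
    intro u hu
    by_contra h
    exact hu.1 (hst h)
  have hinj : InjOn (fun u => (s₀ u + s₁ u) / 2) S := by
    refine StrictMonoOn.injOn fun u hu v hv huv => ?_
    have h0 := strictMonoOn_quantile hac₀ hu.2 hv.2 huv
    have h1 := strictMonoOn_quantile hac₁ hu.2 hv.2 huv
    change s₀ u < s₀ v at h0
    change s₁ u < s₁ v at h1
    change (s₀ u + s₁ u) / 2 < (s₀ v + s₁ v) / 2
    linarith
  have hchange := lintegral_image_eq_lintegral_abs_deriv_mul hS
    (f' := fun u => ((p₀ (s₀ u)).toReal⁻¹ + (p₁ (s₁ u)).toReal⁻¹) / 2)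
    (fun u hu => (((hgoodS u hu).1.2.add (hgoodS u hu).2.2).div_const 2).hasDerivWithinAt) hinj g
  refine le_trans (le_of_eq ?_) (hchange.symm.le.trans (setLIntegral_le_lintegral _ _))
  refine setLIntegral_congr_fun hS fun u hu => ?_
  obtain ⟨⟨⟨h1, h2⟩, -⟩, ⟨h3, h4⟩, -⟩ := hgoodS u hu
  have h5 : 0 < (p₀ (s₀ u)).toReal := ENNReal.toReal_pos h1 h2
  have h6 : 0 < (p₁ (s₁ u)).toReal := ENNReal.toReal_pos h3 h4
  rw [abs_of_pos (by positivity), ENNReal.ofReal_div_of_pos two_pos,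
    ENNReal.ofReal_add (by positivity) (by positivity), ENNReal.ofReal_inv_of_pos h5,
    ENNReal.ofReal_inv_of_pos h6, ENNReal.ofReal_toReal h2, ENNReal.ofReal_toReal h4,
    ENNReal.ofReal_ofNat, Pi.add_apply]

end Quantile

section Knothe

variable {Ω V : Type} [MeasurableSpace Ω] [MeasureSpace V]

/-- Parametrized couplings of pairs of densities in dimension `k`, together with a function `J`
playing the role of the Jacobian determinant of the midpoint map. -/
def KnotheProp (k : ℕ) (V : Type) [AddCommGroup V] [Module ℝ V] [MeasureSpace V] : Prop :=
  ∀ (Ω : Type) [MeasurableSpace Ω] (f : Fin 2 → Ω × V → ℝ≥0∞), (∀ i, Measurable (f i)) →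
    (∀ i ω, ∫⁻ x, f i (ω, x) = 1) →
    ∃ (U : Type) (_ : MeasurableSpace U) (P : Measure U) (X : Fin 2 → Ω × U → V)
      (J : Ω × U → ℝ≥0∞),
      IsProbabilityMeasure P ∧ (∀ i, Measurable (X i)) ∧ Measurable J ∧
      (∀ i ω, P.map (fun u => X i (ω, u)) = volume.withDensity (fun x => f i (ω, x))) ∧
      (∀ ω g, Measurable g →
        ∫⁻ u, J (ω, u) * g ((1 / 2 : ℝ) • (X 0 (ω, u) + X 1 (ω, u))) ∂P ≤ ∫⁻ x, g x) ∧
      ∀ ω (θ : ℝ), 0 < θ → θ * k < 1 → ∀ᵐ u ∂P,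
        (f 0 (ω, X 0 (ω, u)) ^ (-θ) + f 1 (ω, X 1 (ω, u)) ^ (-θ)) / 2 ≤ J (ω, u) ^ θ

/-- The first marginal of a parametrized density on a product. -/
def marg (f : Ω × (ℝ × V) → ℝ≥0∞) (q : Ω × ℝ) : ℝ≥0∞ := ∫⁻ y, f (q.1, (q.2, y))

/-- The quantile function of the first marginal of a parametrized density on a product. -/
def margQuantile (f : Ω × (ℝ × V) → ℝ≥0∞) (q : Ω × ℝ) : ℝ :=
  quantile (volume.withDensity fun x => marg f (q.1, x)) q.2

variable {f : Ω × (ℝ × V) → ℝ≥0∞}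

theorem measurable_slice {X Y Z : Type*} [MeasurableSpace X] [MeasurableSpace Y]
    [MeasurableSpace Z] {h : X × Y → Z} (hh : Measurable h) (x : X) :
    Measurable (fun y => h (x, y)) :=
  hh.comp measurable_prodMk_left

theorem measurable_marg [SFinite (volume : Measure V)] (hf : Measurable f) :
    Measurable (marg f) := by
  have h : Measurable (fun q : (Ω × ℝ) × V => (q.1.1, (q.1.2, q.2))) := by fun_prop
  exact Measurable.lintegral_prod_right' (f := fun q : (Ω × ℝ) × V => f (q.1.1, (q.1.2, q.2)))
    (hf.comp h)

theorem lintegral_marg [SFinite (volume : Measure V)] (hf : Measurable f) (ω : Ω) :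
    ∫⁻ x, marg f (ω, x) = ∫⁻ x, f (ω, x) := by
  have : Measurable (fun x => f (ω, x)) := hf.comp measurable_prodMk_left
  rw [Measure.volume_eq_prod, lintegral_prod _ this.aemeasurable]
  rfl

theorem measurable_margQuantile [SFinite (volume : Measure V)] (hf : Measurable f)
    (h1 : ∀ ω, ∫⁻ x, f (ω, x) = 1) : Measurable (margQuantile f) := by
  refine measurable_quantile (ν := fun ω => volume.withDensity fun x => marg f (ω, x))
    fun x => ?_
  have hprob : ∀ ω, IsProbabilityMeasure (volume.withDensity fun x => marg f (ω, x)) := fun ω =>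
    isProbabilityMeasure_withDensity_of_lintegral (by rw [lintegral_marg hf, h1])
  simp_rw [ProbabilityTheory.cdf_eq_real, Measure.real, withDensity_apply _ measurableSet_Iic]
  exact ((measurable_marg hf).lintegral_prod_right').ennreal_toReal

/-- The conditional density along the second factor at the quantile of the first marginal. -/
def condDensity (φ : V → ℝ≥0∞) (f : Ω × (ℝ × V) → ℝ≥0∞) (q : (Ω × ℝ) × V) : ℝ≥0∞ :=
  open scoped Classical in
  if marg f (q.1.1, margQuantile f q.1) ≠ 0 ∧ marg f (q.1.1, margQuantile f q.1) ≠ ∞ then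
    f (q.1.1, (margQuantile f q.1, q.2)) / marg f (q.1.1, margQuantile f q.1) else φ q.2

theorem measurable_condDensity [SFinite (volume : Measure V)] (hf : Measurable f)
    (h1 : ∀ ω, ∫⁻ x, f (ω, x) = 1) {φ : V → ℝ≥0∞} (hφ : Measurable φ) :
    Measurable (condDensity φ f) := by
  have hs := measurable_margQuantile hf h1
  have hp : Measurable (fun q : (Ω × ℝ) × V => marg f (q.1.1, margQuantile f q.1)) :=
    (measurable_marg hf).comp (by fun_prop)
  refine Measurable.ite ?_ ((hf.comp (by fun_prop)).div hp) (hφ.comp measurable_snd)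
  exact ((hp (measurableSet_singleton 0)).compl).inter (hp (measurableSet_singleton ∞)).compl

theorem lintegral_condDensity [SFinite (volume : Measure V)] (hf : Measurable f)
    {φ : V → ℝ≥0∞} (hφ1 : ∫⁻ y, φ y = 1) (q : Ω × ℝ) :
    ∫⁻ y, condDensity φ f (q, y) = 1 := by
  unfold condDensity
  by_cases h : marg f (q.1, margQuantile f q) ≠ 0 ∧ marg f (q.1, margQuantile f q) ≠ ∞
  · simp only [h, not_false_eq_true, and_self, if_true, ne_eq]
    simp_rw [div_eq_mul_inv]
    have hf' : Measurable (fun y => f (q.1, (margQuantile f q, y))) :=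
      hf.comp (measurable_prodMk_left.comp measurable_prodMk_left)
    rw [lintegral_mul_const _ hf']
    exact ENNReal.mul_inv_cancel h.1 h.2
  · simp only [h, if_false, hφ1]

theorem ae_margQuantile [SFinite (volume : Measure V)] (hf : Measurable f)
    (h1 : ∀ ω, ∫⁻ x, f (ω, x) = 1) (ω : Ω) :
    ∀ᵐ u ∂(volume.restrict (Ioo (0 : ℝ) 1)), marg f (ω, margQuantile f (ω, u)) ≠ 0 ∧
      marg f (ω, margQuantile f (ω, u)) ≠ ∞ := by
  have hm : ∫⁻ x, marg f (ω, x) = 1 := by rw [lintegral_marg hf, h1]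
  exact ae_quantile hm (ae_pos_and_lt_top_withDensity
    ((measurable_marg hf).comp measurable_prodMk_left) hm)

theorem lintegral_condDensity_margQuantile [SFinite (volume : Measure V)] (hf : Measurable f)
    (h1 : ∀ ω, ∫⁻ x, f (ω, x) = 1) (φ : V → ℝ≥0∞) (ω : Ω) {g : ℝ × V → ℝ≥0∞}
    (hg : Measurable g) :
    ∫⁻ u in Ioo (0 : ℝ) 1, ∫⁻ y, condDensity φ f ((ω, u), y) * g (margQuantile f (ω, u), y)
      = ∫⁻ x, f (ω, x) * g x := by
  have hm : ∫⁻ x, marg f (ω, x) = 1 := by rw [lintegral_marg hf, h1]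
  have hmm : Measurable (fun x => marg f (ω, x)) := (measurable_marg hf).comp measurable_prodMk_left
  set G : ℝ → ℝ≥0∞ := fun x => ∫⁻ y, f (ω, (x, y)) / marg f (ω, x) * g (x, y) with hG
  have hGi : Measurable (fun z : ℝ × V => f (ω, (z.1, z.2)) / marg f (ω, z.1) * g (z.1, z.2)) :=
    ((hf.comp (by fun_prop)).div (hmm.comp measurable_fst)).mul (hg.comp (by fun_prop))
  have hGm : Measurable G := hGi.lintegral_prod_right'
  have e1 : ∫⁻ u in Ioo (0 : ℝ) 1, ∫⁻ y, condDensity φ f ((ω, u), y) *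
      g (margQuantile f (ω, u), y) = ∫⁻ u in Ioo (0 : ℝ) 1, G (margQuantile f (ω, u)) := by
    refine lintegral_congr_ae ?_
    filter_upwards [ae_margQuantile hf h1 ω] with u hu
    simp only [hG, condDensity, hu, ne_eq, not_false_eq_true, and_self, if_true]
  rw [e1]
  have hfg : Measurable (fun x => f (ω, x) * g x) := (hf.comp measurable_prodMk_left).mul hg
  unfold margQuantile
  rw [lintegral_quantile hmm hm hGm, Measure.volume_eq_prod,
    lintegral_prod _ hfg.aemeasurable]
  have hfin : ∀ᵐ x : ℝ, marg f (ω, x) < ∞ :=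
    ae_lt_top hmm (by rw [hm]; exact ENNReal.one_ne_top)
  refine lintegral_congr_ae ?_
  filter_upwards [hfin] with x hx
  rcases eq_or_ne (marg f (ω, x)) 0 with h0 | h0
  · rw [h0, zero_mul]
    symm
    rw [marg, lintegral_eq_zero_iff (measurable_slice (measurable_slice hf ω) x)] at h0
    rw [lintegral_eq_zero_iff (measurable_slice hfg x)]
    filter_upwards [h0] with y hy
    have : f (ω, (x, y)) = 0 := hy
    simp [this]
  · rw [hG, ← lintegral_const_mul' _ _ hx.ne]
    refine lintegral_congr fun y => ?_
    rw [← mul_assoc, ENNReal.mul_div_cancel h0 hx.ne]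

variable [AddCommGroup V] [Module ℝ V]

/-- The Knothe coupling of two densities on `ℝ × V`, built from the quantile coupling of the
first marginals and couplings of the conditional densities. -/
theorem KnotheProp.exists_coupling_prod {k : ℕ} [SFinite (volume : Measure V)]
    [MeasurableAdd₂ V] [MeasurableConstSMul ℝ V]
    (hV : KnotheProp k V) {φ : V → ℝ≥0∞} (hφ : Measurable φ) (hφ1 : ∫⁻ y, φ y = 1)
    (f : Fin 2 → Ω × (ℝ × V) → ℝ≥0∞) (hf : ∀ i, Measurable (f i))
    (h1 : ∀ i ω, ∫⁻ x, f i (ω, x) = 1) :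
    ∃ (U : Type) (_ : MeasurableSpace U) (P : Measure U) (Y : Fin 2 → Ω × (ℝ × U) → V)
      (J : Ω × (ℝ × U) → ℝ≥0∞),
      IsProbabilityMeasure P ∧ (∀ i, Measurable (Y i)) ∧ Measurable J ∧
      (∀ i ω, ((volume.restrict (Ioo (0 : ℝ) 1)).prod P).map
          (fun z => (margQuantile (f i) (ω, z.1), Y i (ω, z)))
        = volume.withDensity (fun x => f i (ω, x))) ∧
      (∀ ω g, Measurable g →
        ∫⁻ z, ((marg (f 0) (ω, margQuantile (f 0) (ω, z.1)))⁻¹ +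
            (marg (f 1) (ω, margQuantile (f 1) (ω, z.1)))⁻¹) / 2 * J (ω, z) *
          g ((1 / 2 : ℝ) • ((margQuantile (f 0) (ω, z.1), Y 0 (ω, z)) +
            (margQuantile (f 1) (ω, z.1), Y 1 (ω, z))))
          ∂((volume.restrict (Ioo (0 : ℝ) 1)).prod P) ≤ ∫⁻ x, g x) ∧
      ∀ ω (θ : ℝ), 0 < θ → θ * k < 1 → ∀ᵐ z ∂((volume.restrict (Ioo (0 : ℝ) 1)).prod P),
        ∃ p c : Fin 2 → ℝ≥0∞, (∀ i, p i = marg (f i) (ω, margQuantile (f i) (ω, z.1)) ∧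
          p i ≠ 0 ∧ p i ≠ ∞ ∧ c i ≠ 0 ∧ c i ≠ ∞ ∧
          f i (ω, (margQuantile (f i) (ω, z.1), Y i (ω, z))) = p i * c i) ∧
        (c 0 ^ (-θ) + c 1 ^ (-θ)) / 2 ≤ J (ω, z) ^ θ := by
  have hs := fun i => measurable_margQuantile (hf i) (h1 i)
  have hc := fun i => measurable_condDensity (hf i) (h1 i) hφ
  have hc1 := fun i => lintegral_condDensity (hf i) hφ1
  obtain ⟨U, mU, P, X, J, hP, hX, hJ, hlaw, harea, hθ⟩ :=
    hV (Ω × ℝ) (fun i => condDensity φ (f i)) hc hc1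
  have hassoc : Measurable (fun z : Ω × (ℝ × U) => ((z.1, z.2.1), z.2.2)) := by fun_prop
  refine ⟨U, mU, P, fun i z => X i ((z.1, z.2.1), z.2.2), fun z => J ((z.1, z.2.1), z.2.2), hP,
    fun i => (hX i).comp hassoc, hJ.comp hassoc, fun i ω => ?_, fun ω g hg => ?_,
    fun ω θ hθ0 hθ1 => ?_⟩
  · have hm : Measurable (fun z : ℝ × U => (margQuantile (f i) (ω, z.1), X i ((ω, z.1), z.2))) :=
      ((hs i).comp (by fun_prop)).prodMk ((hX i).comp (by fun_prop))
    refine Measure.ext_of_lintegral _ fun g hg => ?_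
    have hgm : Measurable (fun z : ℝ × U =>
        g (margQuantile (f i) (ω, z.1), X i ((ω, z.1), z.2))) := hg.comp hm
    rw [lintegral_map hg hm, lintegral_prod _ hgm.aemeasurable,
      lintegral_withDensity_eq_lintegral_mul _ (measurable_slice (hf i) ω) hg]
    change _ = ∫⁻ x, f i (ω, x) * g x
    rw [← lintegral_condDensity_margQuantile (hf i) (h1 i) φ ω hg]
    refine lintegral_congr fun u => ?_
    have hg' : Measurable (fun y => g (margQuantile (f i) (ω, u), y)) := hg.comp (by fun_prop)
    rw [← lintegral_map (μ := P) (g := fun w => X i ((ω, u), w)) hg' ((hX i).comp (by fun_prop)),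
      hlaw, lintegral_withDensity_eq_lintegral_mul _ (measurable_slice (hc i) (ω, u)) hg']
    rfl
  · have hm : ∀ i, Measurable (fun z : ℝ × U =>
        (margQuantile (f i) (ω, z.1), X i ((ω, z.1), z.2))) := fun i =>
      ((hs i).comp (by fun_prop)).prodMk ((hX i).comp (by fun_prop))
    have hp : ∀ i, Measurable (fun u : ℝ => (marg (f i) (ω, margQuantile (f i) (ω, u)))⁻¹) :=
      fun i => ((measurable_marg (hf i)).comp
        (measurable_const.prodMk ((hs i).comp (by fun_prop)))).inv
    have hp' : Measurable (fun u : ℝ => ((marg (f 0) (ω, margQuantile (f 0) (ω, u)))⁻¹ +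
            (marg (f 1) (ω, margQuantile (f 1) (ω, u)))⁻¹) / 2) := ((hp 0).add (hp 1)).div_const 2
    have hJ' : Measurable (fun z : ℝ × U => J ((ω, z.1), z.2)) := hJ.comp (by fun_prop)
    have hsum : Measurable (fun z : ℝ × U => g
        ((1 / 2 : ℝ) • ((margQuantile (f 0) (ω, z.1), X 0 ((ω, z.1), z.2)) +
            (margQuantile (f 1) (ω, z.1), X 1 ((ω, z.1), z.2))))) :=
      hg.comp (Measurable.prodMk
        (((hm 0).fst.add (hm 1).fst).const_smul (1 / 2 : ℝ))
        (((hm 0).snd.add (hm 1).snd).const_smul (1 / 2 : ℝ)) :)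
    have htot : Measurable (fun z : ℝ × U =>
        ((marg (f 0) (ω, margQuantile (f 0) (ω, z.1)))⁻¹ +
            (marg (f 1) (ω, margQuantile (f 1) (ω, z.1)))⁻¹) / 2 * J ((ω, z.1), z.2) *
          g ((1 / 2 : ℝ) • ((margQuantile (f 0) (ω, z.1), X 0 ((ω, z.1), z.2)) +
            (margQuantile (f 1) (ω, z.1), X 1 ((ω, z.1), z.2))))) :=
      ((hp'.comp measurable_fst).mul hJ').mul hsum
    set G : ℝ → ℝ≥0∞ := fun x => ∫⁻ y, g (x, y) with hG
    refine (lintegral_prod _ htot.aemeasurable).trans_le ?_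
    rw [Measure.volume_eq_prod ℝ V, lintegral_prod _ hg.aemeasurable]
    refine le_trans ?_ (lintegral_midpoint_quantile_le
      ((measurable_marg (hf 0)).comp measurable_prodMk_left)
      ((measurable_marg (hf 1)).comp measurable_prodMk_left)
      ((lintegral_marg (hf 0) ω).trans (h1 0 ω)) ((lintegral_marg (hf 1) ω).trans (h1 1 ω)) G)
    refine lintegral_mono fun u => ?_
    simp only [mul_assoc]
    rw [lintegral_const_mul _ (by
      exact (hJ'.comp measurable_prodMk_left).mul (hsum.comp measurable_prodMk_left))]
    refine mul_le_mul_right ?_ _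
    have hg' : Measurable (fun y => g
      ((1 / 2 : ℝ) * (margQuantile (f 0) (ω, u) + margQuantile (f 1) (ω, u)), y)) :=
      hg.comp (by fun_prop)
    refine (harea (ω, u) _ hg').trans (le_of_eq ?_)
    rw [one_div_mul_eq_div]
    rfl
  · have hmeas : ∀ i, Measurable (fun z : ℝ × U =>
        condDensity φ (f i) ((ω, z.1), X i ((ω, z.1), z.2))) := fun i =>
      (hc i).comp ((by fun_prop : Measurable fun z : ℝ × U => (ω, z.1)).prodMk
        ((hX i).comp (by fun_prop)))
    have hJ' : Measurable (fun z : ℝ × U => J ((ω, z.1), z.2)) := hJ.comp (by fun_prop)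
    have h2 : ∀ᵐ z ∂((volume.restrict (Ioo (0 : ℝ) 1)).prod P),
        (condDensity φ (f 0) ((ω, z.1), X 0 ((ω, z.1), z.2)) ^ (-θ) +
          condDensity φ (f 1) ((ω, z.1), X 1 ((ω, z.1), z.2)) ^ (-θ)) / 2
          ≤ J ((ω, z.1), z.2) ^ θ := by
      refine (Measure.ae_prod_iff_ae_ae ?_).2 (ae_of_all _ fun u => hθ (ω, u) θ hθ0 hθ1)
      exact measurableSet_le ((((hmeas 0).pow_const _).add ((hmeas 1).pow_const _)).div_const 2)
        (hJ'.pow_const _)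
    have h3 : ∀ i, ∀ᵐ z ∂((volume.restrict (Ioo (0 : ℝ) 1)).prod P),
        condDensity φ (f i) ((ω, z.1), X i ((ω, z.1), z.2)) ≠ 0 ∧
        condDensity φ (f i) ((ω, z.1), X i ((ω, z.1), z.2)) ≠ ∞ := by
      intro i
      refine (Measure.ae_prod_iff_ae_ae ?_).2 (ae_of_all _ fun u => ?_)
      · exact ((hmeas i) (measurableSet_singleton 0)).compl.inter
          ((hmeas i) (measurableSet_singleton ∞)).compl
      · have := ae_pos_and_lt_top_withDensity ((hc i).comp measurable_prodMk_left)
          (hc1 i (ω, u))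
        have h4 := hlaw i (ω, u)
        change _ = volume.withDensity (condDensity φ (f i) ∘ Prod.mk (ω, u)) at h4
        rw [← h4] at this
        exact ae_of_ae_map ((hX i).comp measurable_prodMk_left).aemeasurable this
    have h4 : ∀ i, ∀ᵐ z ∂((volume.restrict (Ioo (0 : ℝ) 1)).prod P),
        marg (f i) (ω, margQuantile (f i) (ω, z.1)) ≠ 0 ∧
        marg (f i) (ω, margQuantile (f i) (ω, z.1)) ≠ ∞ := fun i =>
      Measure.quasiMeasurePreserving_fst.ae (ae_margQuantile (hf i) (h1 i) ω)
    filter_upwards [h2, ae_all_iff.2 h3, ae_all_iff.2 h4] with z hz2 hz3 hz4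
    refine ⟨fun i => marg (f i) (ω, margQuantile (f i) (ω, z.1)),
      fun i => condDensity φ (f i) ((ω, z.1), X i ((ω, z.1), z.2)),
      fun i => ⟨rfl, (hz4 i).1, (hz4 i).2, (hz3 i).1, (hz3 i).2, ?_⟩, hz2⟩
    simp only [condDensity, hz4 i, ne_eq, not_false_eq_true, and_self, if_true]
    rw [ENNReal.mul_div_cancel (hz4 i).1 (hz4 i).2]

end Knothe

theorem mean_rpow_mul_rpow_le {θ η : ℝ} (hθ : 0 < θ) (hη : 0 < η) (hs : θ + η ≤ 1)
    {a₀ a₁ b₀ b₁ : ℝ} (ha₀ : 0 < a₀) (ha₁ : 0 < a₁) (hb₀ : 0 < b₀) (hb₁ : 0 < b₁) :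
    (a₀ ^ θ * b₀ ^ η + a₁ ^ θ * b₁ ^ η) / 2 ≤ ((a₀ + a₁) / 2) ^ θ * ((b₀ + b₁) / 2) ^ η := by
  set A := (a₀ + a₁) / 2
  set B := (b₀ + b₁) / 2
  have hA : 0 < A := by positivity
  have hB : 0 < B := by positivity
  have key : ∀ a b : ℝ, 0 < a → 0 < b →
      a ^ θ * b ^ η ≤ (θ * (a / A) + η * (b / B) + (1 - θ - η)) * (A ^ θ * B ^ η) := by
    intro a b ha hb
    have h := Real.geom_mean_le_arith_mean3_weighted hθ.le hη.le (by linarith : 0 ≤ 1 - θ - η)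
      (div_nonneg ha.le hA.le) (div_nonneg hb.le hB.le) zero_le_one (by ring)
    rw [Real.one_rpow, mul_one, mul_one, Real.div_rpow ha.le hA.le, Real.div_rpow hb.le hB.le,
      div_mul_div_comm, div_le_iff₀ (by positivity)] at h
    exact h
  have h0 := key a₀ b₀ ha₀ hb₀
  have h1 := key a₁ b₁ ha₁ hb₁
  have e : (θ * (a₀ / A) + η * (b₀ / B) + (1 - θ - η)) + (θ * (a₁ / A) + η * (b₁ / B) +
      (1 - θ - η)) = 2 := by
    have e1 : a₀ / A + a₁ / A = 2 := by rw [← add_div, div_eq_iff hA.ne']; simp only [A]; ring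
    have e2 : b₀ / B + b₁ / B = 2 := by rw [← add_div, div_eq_iff hB.ne']; simp only [B]; ring
    linear_combination θ * e1 + η * e2
  have := congrArg (· * (A ^ θ * B ^ η)) e
  simp only [add_mul _ _ (A ^ θ * B ^ η)] at this h0 h1
  linarith

theorem mean_rpow_mul_rpow_lt {θ η : ℝ} (hθ : 0 < θ) (hη : 0 < η) (hs : θ + η < 1)
    {a₀ a₁ b₀ b₁ : ℝ} (ha₀ : 0 < a₀) (ha₁ : 0 < a₁) (hb₀ : 0 < b₀) (hb₁ : 0 < b₁) (h : a₀ ≠ a₁) :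
    (a₀ ^ θ * b₀ ^ η + a₁ ^ θ * b₁ ^ η) / 2 < ((a₀ + a₁) / 2) ^ θ * ((b₀ + b₁) / 2) ^ η := by
  set θ' := 1 - η
  have hθ' : θ < θ' := by simp only [θ']; linarith
  have hr : 0 < θ / θ' := div_pos hθ (hθ.trans hθ')
  have hr1 : θ / θ' < 1 := (div_lt_one (hθ.trans hθ')).2 hθ'
  have e : ∀ a : ℝ, 0 < a → (a ^ (θ / θ')) ^ θ' = a ^ θ := fun a ha => by
    rw [← Real.rpow_mul ha.le, div_mul_cancel₀ _ (hθ.trans hθ').ne']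
  have h1 := mean_rpow_mul_rpow_le (hθ.trans hθ') hη (by simp [θ'])
    (Real.rpow_pos_of_pos ha₀ (θ / θ')) (Real.rpow_pos_of_pos ha₁ (θ / θ')) hb₀ hb₁
  rw [e _ ha₀, e _ ha₁] at h1
  refine h1.trans_lt (mul_lt_mul_of_pos_right ?_ (by positivity))
  rw [← e _ (by positivity : 0 < (a₀ + a₁) / 2)]
  refine Real.rpow_lt_rpow (by positivity) ?_ (hθ.trans hθ')
  have h2 := (Real.strictConcaveOn_rpow hr hr1).2 ha₀.le ha₁.le h (by norm_num : (0 : ℝ) < 1 / 2)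
    (by norm_num : (0 : ℝ) < 1 / 2) (by norm_num)
  simp only [smul_eq_mul] at h2
  rw [show (a₀ + a₁) / 2 = 1 / 2 * a₀ + 1 / 2 * a₁ by ring]
  linarith

theorem mean_rpow_neg_le {θ η : ℝ} (hθ : 0 < θ) (hη : 0 < η) (hs : θ + η ≤ 1)
    {p c : Fin 2 → ℝ≥0∞} {J : ℝ≥0∞}
    (h : ∀ i, p i ≠ 0 ∧ p i ≠ ∞ ∧ c i ≠ 0 ∧ c i ≠ ∞)
    (hJ : (c 0 ^ (-(θ / η)) + c 1 ^ (-(θ / η))) / 2 ≤ J ^ (θ / η)) :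
    ((p 0 * c 0) ^ (-θ) + (p 1 * c 1) ^ (-θ)) / 2 ≤ (((p 0)⁻¹ + (p 1)⁻¹) / 2 * J) ^ θ ∧
    (θ + η < 1 → p 0 ≠ p 1 →
      ((p 0 * c 0) ^ (-θ) + (p 1 * c 1) ^ (-θ)) / 2 < (((p 0)⁻¹ + (p 1)⁻¹) / 2 * J) ^ θ) := by
  have hJ' : ((c 0 ^ (-(θ / η)) + c 1 ^ (-(θ / η))) / 2) ^ η ≤ J ^ θ := by
    have := ENNReal.rpow_le_rpow hJ hη.le
    rwa [← ENNReal.rpow_mul J, div_mul_cancel₀ _ hη.ne'] at this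
  have key : ((p 0 * c 0) ^ (-θ) + (p 1 * c 1) ^ (-θ)) / 2 ≤ (((p 0)⁻¹ + (p 1)⁻¹) / 2) ^ θ *
        ((c 0 ^ (-(θ / η)) + c 1 ^ (-(θ / η))) / 2) ^ η ∧ (θ + η < 1 → p 0 ≠ p 1 →
      ((p 0 * c 0) ^ (-θ) + (p 1 * c 1) ^ (-θ)) / 2 < (((p 0)⁻¹ + (p 1)⁻¹) / 2) ^ θ *
        ((c 0 ^ (-(θ / η)) + c 1 ^ (-(θ / η))) / 2) ^ η) := by
    have hr : ∀ x : ℝ≥0∞, x ≠ 0 → x ≠ ∞ → ∃ r : ℝ, 0 < r ∧ x = ENNReal.ofReal r := fun x h0 h1 =>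
      ⟨x.toReal, ENNReal.toReal_pos h0 h1, (ENNReal.ofReal_toReal h1).symm⟩
    obtain ⟨a₀, ha₀, e0⟩ := hr _ (h 0).1 (h 0).2.1
    obtain ⟨a₁, ha₁, e1⟩ := hr _ (h 1).1 (h 1).2.1
    obtain ⟨b₀, hb₀, e2⟩ := hr _ (h 0).2.2.1 (h 0).2.2.2
    obtain ⟨b₁, hb₁, e3⟩ := hr _ (h 1).2.2.1 (h 1).2.2.2
    have e : ∀ a b : ℝ, 0 < a → 0 < b → a⁻¹ ^ θ * (b ^ (-(θ / η))) ^ η = (a * b) ^ (-θ) := by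
      intro a b ha hb
      rw [← Real.rpow_mul hb.le, neg_mul, div_mul_cancel₀ _ hη.ne', Real.mul_rpow ha.le hb.le,
        Real.inv_rpow ha.le, Real.rpow_neg ha.le]
    have h2 : (2 : ℝ≥0∞) = ENNReal.ofReal 2 := by simp
    rw [e0, e1, e2, e3, h2, ← ENNReal.ofReal_mul ha₀.le, ← ENNReal.ofReal_mul ha₁.le,
      ENNReal.ofReal_rpow_of_pos (by positivity), ENNReal.ofReal_rpow_of_pos (by positivity),
      ENNReal.ofReal_rpow_of_pos hb₀, ENNReal.ofReal_rpow_of_pos hb₁,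
      ← ENNReal.ofReal_inv_of_pos ha₀, ← ENNReal.ofReal_inv_of_pos ha₁,
      ← ENNReal.ofReal_add (by positivity) (by positivity),
      ← ENNReal.ofReal_add (by positivity) (by positivity),
      ← ENNReal.ofReal_add (by positivity) (by positivity),
      ← ENNReal.ofReal_div_of_pos (by positivity), ← ENNReal.ofReal_div_of_pos (by positivity),
      ← ENNReal.ofReal_div_of_pos (by positivity),
      ENNReal.ofReal_rpow_of_pos (by positivity), ENNReal.ofReal_rpow_of_pos (by positivity),
      ← ENNReal.ofReal_mul (by positivity)]
    rw [← e _ _ ha₀ hb₀, ← e _ _ ha₁ hb₁]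
    refine ⟨ENNReal.ofReal_le_ofReal ?_, fun hs' hne => (ENNReal.ofReal_lt_ofReal_iff
      (by positivity)).2 ?_⟩
    · exact mean_rpow_mul_rpow_le hθ hη hs (by positivity) (by positivity) (by positivity)
        (by positivity)
    · refine mean_rpow_mul_rpow_lt hθ hη hs' (by positivity) (by positivity) (by positivity)
        (by positivity) fun h' => hne ?_
      rw [inv_inj.1 h']
  rw [ENNReal.mul_rpow_of_nonneg _ _ hθ.le]
  have hm := mul_le_mul_right hJ' ((((p 0)⁻¹ + (p 1)⁻¹) / 2) ^ θ)
  exact ⟨key.1.trans hm, fun h1 h2 => (key.2 h1 h2).trans_le hm⟩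

section KnotheInduction

variable {V W : Type} [AddCommGroup V] [Module ℝ V] [MeasureSpace V]
  [AddCommGroup W] [Module ℝ W] [MeasureSpace W]

theorem KnotheProp.of_measurableEquiv {k : ℕ} (hV : KnotheProp k V) (e : W ≃ᵐ V)
    (he : MeasurePreserving e) (hlin : ∀ x y,
      e.symm ((1 / 2 : ℝ) • (x + y)) = (1 / 2 : ℝ) • (e.symm x + e.symm y)) :
    KnotheProp k W := by
  intro Ω _ f hf h1
  have hes : MeasurePreserving e.symm := he.symm e
  have hm : ∀ i, Measurable (fun z : Ω × V => f i (z.1, e.symm z.2)) := fun i =>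
    (hf i).comp (by fun_prop)
  obtain ⟨U, mU, P, X, J, hP, hX, hJ, hlaw, harea, hθ⟩ := hV Ω
    (fun i z => f i (z.1, e.symm z.2)) hm fun i ω => by
      rw [← h1 i ω]
      exact hes.lintegral_comp_emb e.symm.measurableEmbedding (fun y => f i (ω, y))
  refine ⟨U, mU, P, fun i z => e.symm (X i z), J, hP, fun i => e.symm.measurable.comp (hX i), hJ,
    fun i ω => ?_, fun ω g hg => ?_, hθ⟩
  · have hXi : Measurable (fun u => X i (ω, u)) := measurable_slice (hX i) ω
    refine Measure.ext_of_lintegral _ fun g hg => ?_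
    have hXe : Measurable (fun u => e.symm (X i (ω, u))) := e.symm.measurable.comp hXi
    refine (lintegral_map hg hXe).trans ?_
    refine (lintegral_map (μ := P) (hg.comp e.symm.measurable) hXi).symm.trans ?_
    rw [hlaw i ω,
      lintegral_withDensity_eq_lintegral_mul _ (measurable_slice (hf i) ω) hg,
      lintegral_withDensity_eq_lintegral_mul _ (measurable_slice (hm i) ω)
        (hg.comp e.symm.measurable)]
    exact hes.lintegral_comp_emb e.symm.measurableEmbedding (fun y => f i (ω, y) * g y)
  · rw [← hes.lintegral_comp_emb e.symm.measurableEmbedding g]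
    refine le_trans (le_of_eq ?_) (harea ω (fun v => g (e.symm v)) (hg.comp e.symm.measurable))
    simp only [hlin]

theorem KnotheProp.of_unique [Unique V] (hvol : (volume : Measure V) = Measure.dirac default) :
    KnotheProp 0 V := by
  intro Ω _ f hf h1
  have hf1 : ∀ i ω v, f i (ω, v) = 1 := fun i ω v => by
    rw [← h1 i ω, hvol, lintegral_dirac' _ (measurable_slice (hf i) ω), Subsingleton.elim v default]
  refine ⟨Unit, inferInstance, Measure.dirac (), fun _ _ => default, fun _ => 1, inferInstance,
    fun i => measurable_const, measurable_const, fun i ω => ?_, fun ω g hg => ?_,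
    fun ω θ hθ0 hθ1 => ?_⟩
  · simp only [hf1]
    rw [withDensity_const, one_smul, hvol, Measure.map_const]
    simp
  · rw [hvol, lintegral_dirac' _ hg, lintegral_dirac]
    rw [one_mul, Subsingleton.elim ((1 / 2 : ℝ) • ((default : V) + default)) default]
  · refine ae_of_all _ fun u => ?_
    simp only [hf1, ENNReal.one_rpow, one_add_one_eq_two]
    exact (ENNReal.div_self (by simp) (by simp)).le

theorem KnotheProp.prod {k : ℕ} [SFinite (volume : Measure V)]
    [MeasurableAdd₂ V] [MeasurableConstSMul ℝ V]
    (hV : KnotheProp k V) {φ : V → ℝ≥0∞} (hφ : Measurable φ) (hφ1 : ∫⁻ y, φ y = 1) :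
    KnotheProp (k + 1) (ℝ × V) := by
  intro Ω _ f hf h1
  obtain ⟨U, mU, P, Y, J, hP, hY, hJ, hlaw, harea, hθ⟩ := hV.exists_coupling_prod hφ hφ1 f hf h1
  have hs : ∀ i, Measurable (fun z : Ω × (ℝ × U) => margQuantile (f i) (z.1, z.2.1)) := fun i =>
    (measurable_margQuantile (hf i) (h1 i)).comp (by fun_prop)
  have hp : ∀ i, Measurable (fun z : Ω × (ℝ × U) =>
      marg (f i) (z.1, margQuantile (f i) (z.1, z.2.1))) := fun i =>
    (measurable_marg (hf i)).comp (measurable_fst.prodMk (hs i))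
  refine ⟨ℝ × U, inferInstance, (volume.restrict (Ioo (0 : ℝ) 1)).prod P,
    fun i z => (margQuantile (f i) (z.1, z.2.1), Y i z),
    fun z => ((marg (f 0) (z.1, margQuantile (f 0) (z.1, z.2.1)))⁻¹ +
      (marg (f 1) (z.1, margQuantile (f 1) (z.1, z.2.1)))⁻¹) / 2 * J z, ?_,
    fun i => (hs i).prodMk (hY i), (((hp 0).inv.add (hp 1).inv).div_const 2).mul hJ, hlaw, harea,
    fun ω θ hθ0 hθ1 => ?_⟩
  · have : IsProbabilityMeasure ((volume : Measure ℝ).restrict (Ioo (0 : ℝ) 1)) := ⟨by simp⟩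
    infer_instance
  · push_cast at hθ1
    have hk : 0 ≤ θ * k := by positivity
    have hη : 0 < 1 - θ := by linarith
    filter_upwards [hθ ω (θ / (1 - θ)) (div_pos hθ0 hη)
      (by rw [div_mul_eq_mul_div, div_lt_one hη]; linarith)] with z hz
    obtain ⟨p, c, hpc, hle⟩ := hz
    have := (mean_rpow_neg_le hθ0 hη (by linarith) (p := p) (c := c) (fun i =>
      ⟨(hpc i).2.1, (hpc i).2.2.1, (hpc i).2.2.2.1, (hpc i).2.2.2.2.1⟩) hle).1
    rw [(hpc 0).2.2.2.2.2, (hpc 1).2.2.2.2.2, ← (hpc 0).1, ← (hpc 1).1]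
    exact this

theorem exists_measurable_lintegral_eq_one (k : ℕ) :
    ∃ φ : (Fin k → ℝ) → ℝ≥0∞, Measurable φ ∧ ∫⁻ y, φ y = 1 := by
  have hm : MeasurableSet (univ.pi fun _ : Fin k => Ioo (0 : ℝ) 1) :=
    MeasurableSet.univ_pi fun _ => measurableSet_Ioo
  refine ⟨(univ.pi fun _ : Fin k => Ioo (0 : ℝ) 1).indicator 1, measurable_one.indicator hm, ?_⟩
  rw [lintegral_indicator_one hm, volume_pi_pi]
  simp

theorem knotheProp_pi (k : ℕ) : KnotheProp k (Fin k → ℝ) := by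
  induction k with
  | zero => exact KnotheProp.of_unique (by
      rw [volume_pi, Measure.pi_of_empty (x := Unique.instInhabited.default)])
  | succ k ih =>
    obtain ⟨φ, hφ, hφ1⟩ := exists_measurable_lintegral_eq_one k
    refine (ih.prod hφ hφ1).of_measurableEquiv
      (MeasurableEquiv.piFinSuccAbove (fun _ => ℝ) 0)
      (volume_preserving_piFinSuccAbove (fun _ => ℝ) 0) fun x y => ?_
    ext i
    refine Fin.cases ?_ (fun j => ?_) i <;> simp [MeasurableEquiv.piFinSuccAbove] <;> ring

end KnotheInduction

section Jacobian

variable {Z E : Type*} [MeasurableSpace Z] [MeasurableSpace E] {Q : Measure Z} {m : Measure E}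
  {r : E → ℝ≥0∞} {M : Z → E} {θ : ℝ}

theorem ae_comp_pos_and_lt_top (hM : Measurable M) (hr : Measurable r)
    (hr1 : ∫⁻ x, r x ∂m = 1) (hlaw : Q.map M = m.withDensity r) :
    ∀ᵐ z ∂Q, r (M z) ≠ 0 ∧ r (M z) ≠ ∞ := by
  have := ae_pos_and_lt_top_withDensity hr hr1
  rw [← hlaw] at this
  exact ae_of_ae_map hM.aemeasurable this

theorem lintegral_rpow_neg_comp (hM : Measurable M) (hr : Measurable r)
    (hr1 : ∫⁻ x, r x ∂m = 1) (hlaw : Q.map M = m.withDensity r) (hθ1 : θ < 1) :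
    ∫⁻ z, r (M z) ^ (-θ) ∂Q = ∫⁻ x, r x ^ (1 - θ) ∂m := by
  have hr' : Measurable (fun x => r x ^ (-θ)) := hr.pow_const _
  rw [← lintegral_map hr' hM, hlaw, lintegral_withDensity_eq_lintegral_mul _ hr hr']
  have hfin : ∀ᵐ x ∂m, r x < ∞ := ae_lt_top hr (by rw [hr1]; exact ENNReal.one_ne_top)
  refine lintegral_congr_ae ?_
  filter_upwards [hfin] with x hx
  change r x * r x ^ (-θ) = _
  rcases eq_or_ne (r x) 0 with h0 | h0
  · rw [h0, zero_mul, ENNReal.zero_rpow_of_pos (by linarith)]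
  · rw [sub_eq_add_neg, ENNReal.rpow_add _ _ h0 hx.ne, ENNReal.rpow_one]

theorem map_absolutelyContinuous_of_lintegral_le {D : Z → ℝ≥0∞} (hM : Measurable M)
    (hD : Measurable D) (hD0 : ∀ᵐ z ∂Q, D z ≠ 0)
    (harea : ∀ g, Measurable g → ∫⁻ z, D z * g (M z) ∂Q ≤ ∫⁻ x, g x ∂m) : Q.map M ≪ m := by
  refine Measure.AbsolutelyContinuous.mk fun s hs h0 => ?_
  have hi : Measurable (s.indicator (1 : E → ℝ≥0∞)) := measurable_one.indicator hs
  have h := harea _ hi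
  have hm : Measurable (fun z => D z * s.indicator (1 : E → ℝ≥0∞) (M z)) := hD.mul (hi.comp hM)
  rw [lintegral_indicator_one hs, h0, nonpos_iff_eq_zero, lintegral_eq_zero_iff hm] at h
  rw [Measure.map_apply hM hs]
  refine measure_mono_null (fun z hz => ?_) (ae_iff.1 (h.and hD0))
  intro hz'
  have h1 : D z * s.indicator 1 (M z) = 0 := hz'.1
  rw [indicator_of_mem (show M z ∈ s from hz), Pi.one_apply, mul_one] at h1
  exact hz'.2 h1

theorem lintegral_rpow_le_of_lintegral_le {D : Z → ℝ≥0∞} (hM : Measurable M) (hD : Measurable D)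
    (hr : Measurable r) (hr1 : ∫⁻ x, r x ∂m = 1) (hlaw : Q.map M = m.withDensity r)
    (hθ0 : 0 < θ) (hθ1 : θ < 1)
    (harea : ∀ g, Measurable g → ∫⁻ z, D z * g (M z) ∂Q ≤ ∫⁻ x, g x ∂m) :
    ∫⁻ z, D z ^ θ ∂Q ≤ ∫⁻ x, r x ^ (1 - θ) ∂m := by
  set I := ∫⁻ x, r x ^ (1 - θ) ∂m with hI
  have hα : 0 < 1 - θ := by linarith
  have e1 : ∫⁻ z, D z ^ θ ∂Q =
      ∫⁻ z, (D z * r (M z) ^ (1 - θ)) ^ θ * (r (M z) ^ (-θ)) ^ (1 - θ) ∂Q := by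
    refine lintegral_congr_ae ?_
    filter_upwards [ae_comp_pos_and_lt_top hM hr hr1 hlaw] with z hz
    rw [ENNReal.mul_rpow_of_nonneg _ _ hθ0.le, mul_assoc, ← ENNReal.rpow_mul, ← ENNReal.rpow_mul,
      ← ENNReal.rpow_add _ _ hz.1 hz.2, show (1 - θ) * θ + -θ * (1 - θ) = 0 by ring,
      ENNReal.rpow_zero, mul_one]
  rw [e1]
  have hr2 : ∀ β : ℝ, Measurable (fun z => r (M z) ^ β) := fun β => (hr.comp hM).pow_const β
  have h2 := ENNReal.lintegral_mul_norm_pow_le (μ := Q)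
    (f := fun z => D z * r (M z) ^ (1 - θ)) (g := fun z => r (M z) ^ (-θ))
    (hD.mul (hr2 _)).aemeasurable (hr2 _).aemeasurable hθ0.le hα.le (by ring)
  refine h2.trans ?_
  rw [lintegral_rpow_neg_comp hM hr hr1 hlaw hθ1, ← hI]
  calc _ ≤ I ^ θ * I ^ (1 - θ) := by
        gcongr
        exact harea (fun x => r x ^ (1 - θ)) (hr.pow_const _)
    _ = I := by rw [← ENNReal.rpow_add_of_nonneg _ _ hθ0.le hα.le]; simp

end Jacobian

theorem ae_eq_jacobian_rpow {n : ℕ} {Z : Type*} [MeasurableSpace Z] {Q : Measure Z}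
    [IsProbabilityMeasure Q] {N : ℝ} (hN : (n : ℝ) + 1 < N) {μ : Measure (En n)} (hμ1 : P1 μ)
    {r : Fin 2 → En n → ℝ≥0∞} {X : Fin 2 → Z → En n} {D : Z → ℝ≥0∞} {τ : Fin 2 → ℝ}
    (hr : ∀ i, Measurable (r i)) (hr1 : ∀ i, ∫⁻ x, r i x = 1)
    (hX : ∀ i, Measurable (X i)) (hD : Measurable D)
    (hlaw : ∀ i, Q.map (X i) = volume.withDensity (r i))
    (hP1 : ∀ i, P1 (Q.map (X i))) (hτ : ∀ i, Tcorr (Q.map (X i)) μ ≤ τ i)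
    (hmin : ∀ i ν, IsProbabilityMeasure ν → P1 ν → ∀ c : ℝ, Tcorr ν μ ≤ c →
      (powInt (1 - 1 / N) ν).toReal ≤
        (powInt (1 - 1 / N) (Q.map (X i))).toReal + (1 - 1 / N) * (c - τ i))
    (harea : ∀ g, Measurable g →
      ∫⁻ z, D z * g ((1 / 2 : ℝ) • X 0 z + (1 / 2 : ℝ) • X 1 z) ∂Q ≤ ∫⁻ x, g x)
    (hle : ∀ᵐ z ∂Q, (r 0 (X 0 z) ^ (-(1 / N)) + r 1 (X 1 z) ^ (-(1 / N))) / 2 ≤ D z ^ (1 / N)) :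
    ∀ᵐ z ∂Q, (r 0 (X 0 z) ^ (-(1 / N)) + r 1 (X 1 z) ^ (-(1 / N))) / 2 = D z ^ (1 / N) := by
  have hN1 : 1 < N := by have : (0 : ℝ) ≤ n := n.cast_nonneg; linarith
  have hN0 : 0 < N := by linarith
  have hθ0 : 0 < 1 / N := by positivity
  have hθ1 : 1 / N < 1 := (div_lt_one hN0).2 hN1
  set M : Z → En n := fun z => (1 / 2 : ℝ) • X 0 z + (1 / 2 : ℝ) • X 1 z with hMdef
  have hM : Measurable M := by
    have h0 := hX 0
    have h1 := hX 1
    fun_prop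
  have hpos := fun i => ae_comp_pos_and_lt_top (hX i) (hr i) (hr1 i) (hlaw i)
  have hD0 : ∀ᵐ z ∂Q, D z ≠ 0 := by
    filter_upwards [hle, hpos 0] with z hz h0 hDz
    rw [hDz, ENNReal.zero_rpow_of_pos hθ0, nonpos_iff_eq_zero, ENNReal.div_eq_zero_iff,
      add_eq_zero] at hz
    rcases hz with hz | hz
    · rw [ENNReal.rpow_eq_zero_iff] at hz
      rcases hz.1 with h | h
      · exact h0.1 h.1 |>.elim
      · exact h0.2 h.1
    · exact ENNReal.ofNat_ne_top hz
  have hac : Q.map M ≪ volume := map_absolutelyContinuous_of_lintegral_le hM hD hD0 harea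
  have hMp : IsProbabilityMeasure (Q.map M) := Measure.isProbabilityMeasure_map hM.aemeasurable
  have hXp : ∀ i, IsProbabilityMeasure (Q.map (X i)) := fun i =>
    Measure.isProbabilityMeasure_map (hX i).aemeasurable
  set r' := (Q.map M).rnDeriv volume
  have hr' : Measurable r' := Measure.measurable_rnDeriv _ _
  have hlaw' : Q.map M = volume.withDensity r' := (Measure.withDensity_rnDeriv_eq _ _ hac).symm
  have hr1' : ∫⁻ x, r' x = 1 := by rw [Measure.lintegral_rnDeriv hac, measure_univ]
  have hinner : ∀ i, Integrable (X i) Q := fun i => by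
    have : Integrable (fun z => ‖X i z‖) Q :=
      (integrable_map_measure (by fun_prop) (hX i).aemeasurable).1 (hP1 i)
    exact (integrable_norm_iff (hX i).aestronglyMeasurable).1 this
  have hMP1 : P1 (Q.map M) := by
    refine (integrable_map_measure (by fun_prop) hM.aemeasurable).2 ?_
    exact (((hinner 0).smul (1 / 2 : ℝ)).add ((hinner 1).smul (1 / 2 : ℝ))).norm
  have hT := Tcorr_map_add_le Q (hX 0) (hX 1) hμ1 (hP1 0) (hP1 1)
    (by norm_num : (0 : ℝ) ≤ 1 / 2) (by norm_num : (0 : ℝ) ≤ 1 / 2) (hτ 0) (hτ 1)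
  have m0 := hmin 0 _ hMp hMP1 _ hT
  have m1 := hmin 1 _ hMp hMP1 _ hT
  have hfin : ∀ i, powInt (1 - 1 / N) (Q.map (X i)) ≠ ∞ := fun i => powInt_ne_top hN _ (hP1 i)
  have hfinM : powInt (1 - 1 / N) (Q.map M) ≠ ∞ := powInt_ne_top hN _ hMP1
  have hpow : powInt (1 - 1 / N) (Q.map M) ≤
      (powInt (1 - 1 / N) (Q.map (X 0)) + powInt (1 - 1 / N) (Q.map (X 1))) / 2 := by
    rw [← ENNReal.toReal_le_toReal hfinM (ENNReal.div_ne_top (ENNReal.add_ne_top.2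
      ⟨hfin 0, hfin 1⟩) (by simp)), ENNReal.toReal_div, ENNReal.toReal_add (hfin 0) (hfin 1)]
    simp only [ENNReal.toReal_ofNat]
    rw [le_div_iff₀ (by norm_num)]
    linarith
  have hXr : ∀ i, ∫⁻ z, r i (X i z) ^ (-(1 / N)) ∂Q = powInt (1 - 1 / N) (Q.map (X i)) := fun i => by
    rw [lintegral_rpow_neg_comp (hX i) (hr i) (hr1 i) (hlaw i) hθ1, hlaw i,
      powInt_withDensity _ (hr i)]
  have hrm : ∀ i, Measurable (fun z => r i (X i z) ^ (-(1 / N))) := fun i =>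
    ((hr i).comp (hX i)).pow_const _
  have hL : ∫⁻ z, (r 0 (X 0 z) ^ (-(1 / N)) + r 1 (X 1 z) ^ (-(1 / N))) / 2 ∂Q =
      (powInt (1 - 1 / N) (Q.map (X 0)) + powInt (1 - 1 / N) (Q.map (X 1))) / 2 := by
    simp_rw [div_eq_mul_inv _ (2 : ℝ≥0∞)]
    have hsum : Measurable (fun z => r 0 (X 0 z) ^ (-(1 / N)) + r 1 (X 1 z) ^ (-(1 / N))) :=
      (hrm 0).add (hrm 1)
    rw [lintegral_mul_const _ hsum, lintegral_add_left (hrm 0), hXr, hXr]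
  refine ae_eq_of_ae_le_of_lintegral_le hle ?_ (hD.pow_const _).aemeasurable ?_
  · rw [hL]
    exact ENNReal.div_ne_top (ENNReal.add_ne_top.2 ⟨hfin 0, hfin 1⟩) (by simp)
  · rw [hL]
    exact (lintegral_rpow_le_of_lintegral_le hM hD hr' hr1' hlaw' hθ0 hθ1 harea).trans hpow

theorem exists_measurePreserving_inner_fst {k : ℕ} {e : En (k + 1)} (he : ‖e‖ = 1) :
    ∃ L : En (k + 1) ≃ᵐ ℝ × (Fin k → ℝ), MeasurePreserving L ∧
      (∀ x y, L.symm ((1 / 2 : ℝ) • (x + y)) =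
        (1 / 2 : ℝ) • L.symm x + (1 / 2 : ℝ) • L.symm y) ∧ ∀ x, (L x).1 = ⟪e, x⟫ := by
  have horth : Orthonormal ℝ (({0} : Set (Fin (k + 1))).domRestrict fun _ => e) :=
    ⟨fun _ => he, fun i j hij => (hij (Subsingleton.elim i j)).elim⟩
  obtain ⟨b, hb⟩ := horth.exists_orthonormalBasis_extension_of_card_eq (by simp)
  have hb0 : b 0 = e := hb 0 rfl
  set L := (b.measurableEquiv.trans (MeasurableEquiv.toLp 2 (Fin (k + 1) → ℝ)).symm).trans
    (MeasurableEquiv.piFinSuccAbove (fun _ => ℝ) 0) with hL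
  have hL1 : ∀ x, (L x).1 = b.repr x 0 := fun x => rfl
  have hL2 : ∀ x i, (L x).2 i = b.repr x i.succ := fun x i => rfl
  refine ⟨L, ?_, fun x y => ?_, fun x => ?_⟩
  · exact ((volume_preserving_piFinSuccAbove (fun _ => ℝ) 0).comp
      (PiLp.volume_preserving_ofLp (Fin (k + 1)))).comp b.measurePreserving_measurableEquiv
  · rw [MeasurableEquiv.symm_apply_eq]
    obtain ⟨x, rfl⟩ := L.surjective x
    obtain ⟨y, rfl⟩ := L.surjective y
    simp only [MeasurableEquiv.symm_apply_apply]
    refine Prod.ext ?_ (funext fun i => ?_)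
    · simp [hL1]
    · simp [hL2]
  · rw [hL1, b.repr_apply_apply, hb0]

theorem exists_directional_densities {k : ℕ} {N : ℝ} (hN : ((k + 1 : ℕ) : ℝ) + 1 < N)
    {μ : Measure (En (k + 1))} (hμ1 : P1 μ) {ρ : Fin 2 → Measure (En (k + 1))}
    [∀ i, IsProbabilityMeasure (ρ i)] (hρ1 : ∀ i, P1 (ρ i)) (hac : ∀ i, ρ i ≪ volume)
    {τ : Fin 2 → ℝ} (hτ : ∀ i, Tcorr (ρ i) μ ≤ τ i)
    (hmin : ∀ i ν, IsProbabilityMeasure ν → P1 ν → ∀ c : ℝ, Tcorr ν μ ≤ c →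
      (powInt (1 - 1 / N) ν).toReal ≤ (powInt (1 - 1 / N) (ρ i)).toReal + (1 - 1 / N) * (c - τ i))
    {e : En (k + 1)} (he : ‖e‖ = 1) :
    ∃ p : Fin 2 → ℝ → ℝ≥0∞, (∀ i, Measurable (p i)) ∧ (∀ i, ∫⁻ x, p i x = 1) ∧
      (∀ i, (ρ i).map (fun x => ⟪e, x⟫) = volume.withDensity (p i)) ∧
      ∀ᵐ u ∂(volume.restrict (Ioo (0 : ℝ) 1)), p 0 (quantile (volume.withDensity (p 0)) u) =
        p 1 (quantile (volume.withDensity (p 1)) u) := by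
  obtain ⟨L, hL, hLlin, hLe⟩ := exists_measurePreserving_inner_fst he
  have hLs : MeasurePreserving L.symm := hL.symm L
  set r : Fin 2 → En (k + 1) → ℝ≥0∞ := fun i => (ρ i).rnDeriv volume with hrdef
  have hr : ∀ i, Measurable (r i) := fun i => Measure.measurable_rnDeriv _ _
  have hρr : ∀ i, ρ i = volume.withDensity (r i) := fun i =>
    (Measure.withDensity_rnDeriv_eq _ _ (hac i)).symm
  have hr1 : ∀ i, ∫⁻ x, r i x = 1 := fun i => by
    rw [hrdef, Measure.lintegral_rnDeriv (hac i), measure_univ]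
  set f : Fin 2 → Unit × (ℝ × (Fin k → ℝ)) → ℝ≥0∞ := fun i z => r i (L.symm z.2) with hfdef
  have hf : ∀ i, Measurable (f i) := fun i => (hr i).comp (by fun_prop)
  have hf1 : ∀ i ω, ∫⁻ x, f i (ω, x) = 1 := fun i ω => by
    rw [← hr1 i]
    exact hLs.lintegral_comp_emb L.symm.measurableEmbedding (r i)
  obtain ⟨φ, hφ, hφ1⟩ := exists_measurable_lintegral_eq_one k
  obtain ⟨U, mU, P, Y, J, hP, hY, hJ, hlaw, harea, hθ⟩ :=
    (knotheProp_pi k).exists_coupling_prod hφ hφ1 f hf hf1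
  have hp : ∀ i, Measurable (fun x => marg (f i) ((), x)) := fun i =>
    measurable_slice (measurable_marg (hf i)) ()
  have hp1 : ∀ i, ∫⁻ x, marg (f i) ((), x) = 1 := fun i => by rw [lintegral_marg (hf i), hf1]
  refine ⟨fun i x => marg (f i) ((), x), hp, hp1, fun i => ?_, ?_⟩
  · have hin : Measurable (fun x : En (k + 1) => ⟪e, x⟫) := by fun_prop
    refine Measure.ext_of_lintegral _ fun g hg => ?_
    rw [lintegral_map hg hin, lintegral_withDensity_eq_lintegral_mul _ (hp i) hg]
    have hgi : Measurable (fun x : En (k + 1) => g ⟪e, x⟫) := hg.comp hin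
    conv_lhs => rw [hρr i]
    rw [lintegral_withDensity_eq_lintegral_mul _ (hr i) hgi,
      ← hLs.lintegral_comp_emb L.symm.measurableEmbedding]
    have hm : Measurable (fun z : ℝ × (Fin k → ℝ) => f i ((), z) * g z.1) :=
      (measurable_slice (hf i) ()).mul (hg.comp measurable_fst)
    calc _ = ∫⁻ z : ℝ × (Fin k → ℝ), f i ((), z) * g z.1 := by
          refine lintegral_congr fun z => ?_
          simp only [Pi.mul_apply, ← hLe, L.apply_symm_apply, hfdef]
      _ = _ := by
          rw [Measure.volume_eq_prod, lintegral_prod _ hm.aemeasurable]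
          refine lintegral_congr fun x => ?_
          exact lintegral_mul_const (g x) (measurable_slice (measurable_slice (hf i) ()) x)
  · have : IsProbabilityMeasure ((volume : Measure ℝ).restrict (Ioo (0 : ℝ) 1)) := ⟨by simp⟩
    have hs : ∀ i, Measurable (fun z : ℝ × U => margQuantile (f i) ((), z.1)) := fun i =>
      (measurable_margQuantile (hf i) (hf1 i)).comp (by fun_prop)
    have hpm : ∀ i, Measurable (fun z : ℝ × U =>
        marg (f i) ((), margQuantile (f i) ((), z.1))) := fun i => (hp i).comp (hs i)
    set X : Fin 2 → ℝ × U → En (k + 1) := fun i z =>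
      L.symm (margQuantile (f i) ((), z.1), Y i ((), z)) with hXdef
    have hXm : ∀ i, Measurable (fun z : ℝ × U => (margQuantile (f i) ((), z.1), Y i ((), z))) :=
      fun i => (hs i).prodMk (measurable_slice (hY i) ())
    have hX : ∀ i, Measurable (X i) := fun i => L.symm.measurable.comp (hXm i)
    set Q := (volume.restrict (Ioo (0 : ℝ) 1)).prod P with hQ
    have hXlaw : ∀ i, Q.map (X i) = ρ i := fun i => by
      refine Measure.ext_of_lintegral _ fun g hg => ?_
      have hgL : Measurable (fun z => g (L.symm z)) := hg.comp L.symm.measurable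
      rw [lintegral_map hg (hX i)]
      refine (lintegral_map (μ := Q) hgL (hXm i)).symm.trans ?_
      rw [hlaw i (), lintegral_withDensity_eq_lintegral_mul _ (measurable_slice (hf i) ()) hgL]
      conv_rhs => rw [hρr i]
      rw [lintegral_withDensity_eq_lintegral_mul _ (hr i) hg]
      exact hLs.lintegral_comp_emb L.symm.measurableEmbedding (fun x => r i x * g x)
    set D : ℝ × U → ℝ≥0∞ := fun z => ((marg (f 0) ((), margQuantile (f 0) ((), z.1)))⁻¹ +
      (marg (f 1) ((), margQuantile (f 1) ((), z.1)))⁻¹) / 2 * J ((), z) with hDdef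
    have hD : Measurable D :=
      (((hpm 0).inv.add (hpm 1).inv).div_const 2).mul (measurable_slice hJ ())
    have hk : (0 : ℝ) ≤ k := k.cast_nonneg
    push_cast at hN
    have hN0 : 0 < N := by linarith
    have hθ0 : 0 < 1 / N := by positivity
    have hk2 : (k + 2) * (1 / N) < 1 := by
      rw [mul_one_div, div_lt_one hN0]
      linarith
    have hη : 0 < 1 - 1 / N - 1 / N / 2 := by nlinarith
    have hpt : ∀ᵐ z ∂Q, (r 0 (X 0 z) ^ (-(1 / N)) + r 1 (X 1 z) ^ (-(1 / N))) / 2 ≤ D z ^ (1 / N) ∧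
        (marg (f 0) ((), margQuantile (f 0) ((), z.1)) ≠
          marg (f 1) ((), margQuantile (f 1) ((), z.1)) →
        (r 0 (X 0 z) ^ (-(1 / N)) + r 1 (X 1 z) ^ (-(1 / N))) / 2 < D z ^ (1 / N)) := by
      filter_upwards [hθ () (1 / N / (1 - 1 / N - 1 / N / 2)) (div_pos hθ0 hη)
        (by rw [div_mul_eq_mul_div, div_lt_one hη]; nlinarith)] with z hz
      obtain ⟨p, c, hpc, hle⟩ := hz
      have key := mean_rpow_neg_le hθ0 hη (by linarith) (p := p) (c := c) (fun i =>
        ⟨(hpc i).2.1, (hpc i).2.2.1, (hpc i).2.2.2.1, (hpc i).2.2.2.2.1⟩) hle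
      have e' : ∀ i, r i (X i z) = p i * c i := fun i => (hpc i).2.2.2.2.2
      have eD : D z = ((p 0)⁻¹ + (p 1)⁻¹) / 2 * J ((), z) := by rw [(hpc 0).1, (hpc 1).1]
      rw [e', e', eD, ← (hpc 0).1, ← (hpc 1).1]
      exact ⟨key.1, key.2 (by linarith)⟩
    have heq := ae_eq_jacobian_rpow (N := N) (Q := Q) (by push_cast; linarith) hμ1 hr hr1 hX hD
      (fun i => (hXlaw i).trans (hρr i)) (fun i => by rw [hXlaw]; exact hρ1 i)
      (fun i => by rw [hXlaw]; exact hτ i) (fun i => by rw [hXlaw]; exact hmin i)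
      (fun g hg => by
        refine le_trans (le_of_eq ?_) ((harea () (fun z => g (L.symm z))
          (hg.comp L.symm.measurable)).trans_eq
          (hLs.lintegral_comp_emb L.symm.measurableEmbedding g))
        simp only [hLlin, hXdef, hDdef])
      (hpt.mono fun z hz => hz.1)
    have hz : ∀ᵐ z ∂Q, marg (f 0) ((), margQuantile (f 0) ((), z.1)) =
        marg (f 1) ((), margQuantile (f 1) ((), z.1)) := by
      filter_upwards [hpt, heq] with z hz1 hz2
      by_contra hne
      exact (hz1.2 hne).ne hz2
    have := Measure.ae_ae_of_ae_prod hz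
    filter_upwards [this] with u hu
    exact hu.exists.choose_spec

theorem volume_zeros_inter_Ioo_eq_zero {p : ℝ → ℝ≥0∞} (hp : Measurable p)
    (hp1 : ∫⁻ x, p x = 1)
    (hac : ∀ t : ℝ, 0 < t → t < 1 →
      ((volume.withDensity p).prod (volume.withDensity p)).map
        (fun z => (1 - t) * z.1 + t * z.2) ≪ volume.withDensity p)
    {u v : ℝ} (hu : u ∈ Ioo (0 : ℝ) 1) (hv : v ∈ Ioo (0 : ℝ) 1) :
    volume (p ⁻¹' {0} ∩ Ioo (quantile (volume.withDensity p) u)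
      (quantile (volume.withDensity p) v)) = 0 := by
  have hprob := isProbabilityMeasure_withDensity_of_lintegral hp1
  set ν := volume.withDensity p with hν
  have hνac : ν ≪ volume := withDensity_absolutelyContinuous _ _
  have hZ : MeasurableSet (p ⁻¹' {0}) := hp (measurableSet_singleton 0)
  have hνZ : ν (p ⁻¹' {0}) = 0 := by
    have := ae_iff.1 (ae_pos_and_lt_top_withDensity hp hp1)
    refine measure_mono_null (fun x hx => ?_) this
    exact fun h => h.1 hx
  have h1 : ∀ᵐ z ∂((volume.restrict (Ioo (0 : ℝ) 1)).prod (ν.prod ν)),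
      (1 - z.1) * z.2.1 + z.1 * z.2.2 ∉ p ⁻¹' {0} := by
    refine (Measure.ae_prod_iff_ae_ae ?_).2 ?_
    · exact ((by fun_prop : Measurable (fun z : ℝ × (ℝ × ℝ) =>
        (1 - z.1) * z.2.1 + z.1 * z.2.2)) hZ).compl
    · filter_upwards [ae_restrict_mem measurableSet_Ioo] with t ht
      have hm : Measurable (fun z : ℝ × ℝ => (1 - t) * z.1 + t * z.2) := by fun_prop
      exact ae_of_ae_map hm.aemeasurable (measure_eq_zero_iff_ae_notMem.1 (hac t ht.1 ht.2 hνZ))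
  have h2 : ∀ᵐ z ∂(ν.prod ν), ∀ᵐ t ∂(volume.restrict (Ioo (0 : ℝ) 1)),
      (1 - t) * z.1 + t * z.2 ∉ p ⁻¹' {0} :=
    Measure.ae_ae_of_ae_prod (Measure.measurePreserving_swap.quasiMeasurePreserving.ae h1)
  have hlow : ν (Iio (quantile ν u)) ≠ 0 := by
    have h3 : ν (Iic (quantile ν u)) ≠ 0 := by
      rw [← ProbabilityTheory.ofReal_cdf, cdf_quantile hνac hu]
      simpa using hu.1
    rwa [← measure_congr (Iio_ae_eq_Iic' (hνac (by simp)))] at h3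
  have hhigh : ν (Ioi (quantile ν v)) ≠ 0 := by
    rw [← compl_Iic, ne_eq, prob_compl_eq_zero_iff measurableSet_Iic, ← ProbabilityTheory.ofReal_cdf,
      cdf_quantile hνac hv]
    simpa using hv.2.ne
  have hprod : (ν.prod ν) (Iio (quantile ν u) ×ˢ Ioi (quantile ν v)) ≠ 0 := by
    rw [Measure.prod_prod]
    exact mul_ne_zero hlow hhigh
  obtain ⟨⟨a, b⟩, hab, hz⟩ := (frequently_ae_mem_iff.2 hprod).and_eventually h2 |>.exists
  have ha : a < quantile ν u := hab.1
  have hb : quantile ν v < b := hab.2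
  rcases le_or_gt (quantile ν v) (quantile ν u) with hvu | huv
  · simp [Ioo_eq_empty (not_lt.2 hvu)]
  have hlt : 0 < b - a := by linarith
  refine measure_mono_null (t := p ⁻¹' {0} ∩ Ioo a b)
    (inter_subset_inter_right _ (Ioo_subset_Ioo ha.le hb.le)) ?_
  have h4 : volume ((fun t => t * (b - a)) ⁻¹' ((fun x => a + x) ⁻¹' (p ⁻¹' {0} ∩ Ioo a b))) = 0 := by
    rw [ae_restrict_iff' measurableSet_Ioo] at hz
    have hz' := ae_iff.1 hz
    refine measure_mono_null (fun t ht => ?_) hz'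
    intro hcon
    have h5 : a < a + t * (b - a) := ht.2.1
    have h6 : a + t * (b - a) < b := ht.2.2
    refine hcon ⟨?_, ?_⟩ ?_
    · exact pos_of_mul_pos_left (by linarith) hlt.le
    · by_contra h7
      nlinarith [not_lt.1 h7]
    · have := ht.1
      rw [mem_preimage] at this ⊢
      rwa [show (1 - t) * a + t * b = a + t * (b - a) by ring]
  rw [Real.volume_preimage_mul_right hlt.ne', measure_preimage_add, mul_eq_zero,
    ENNReal.ofReal_eq_zero] at h4
  exact h4.resolve_left (not_le.2 (by positivity))

theorem ofReal_quantile_sub {p : ℝ → ℝ≥0∞} (hp : Measurable p) (hp1 : ∫⁻ x, p x = 1)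
    (hac : ∀ t : ℝ, 0 < t → t < 1 →
      ((volume.withDensity p).prod (volume.withDensity p)).map
        (fun z => (1 - t) * z.1 + t * z.2) ≪ volume.withDensity p)
    {u v : ℝ} (hu : u ∈ Ioo (0 : ℝ) 1) (hv : v ∈ Ioo (0 : ℝ) 1) :
    ENNReal.ofReal (quantile (volume.withDensity p) v - quantile (volume.withDensity p) u) =
      ∫⁻ w in Ioo u v, (p (quantile (volume.withDensity p) w))⁻¹ := by
  have h0 := volume_zeros_inter_Ioo_eq_zero hp hp1 hac hu hv
  have hprob := isProbabilityMeasure_withDensity_of_lintegral hp1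
  have hmono := strictMonoOn_quantile (withDensity_absolutelyContinuous volume p)
  set s := quantile (volume.withDensity p)
  set g : ℝ → ℝ≥0∞ := (Ioo (s u) (s v)).indicator (fun x => (p x)⁻¹) with hg
  have hgm : Measurable g := hp.inv.indicator measurableSet_Ioo
  have e1 : ∫⁻ w in Ioo u v, (p (s w))⁻¹ = ∫⁻ w in Ioo (0 : ℝ) 1, g (s w) := by
    rw [← lintegral_indicator measurableSet_Ioo, ← lintegral_indicator measurableSet_Ioo]
    congr 1 with w
    by_cases hw : w ∈ Ioo (0 : ℝ) 1
    · rw [indicator_of_mem hw]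
      simp only [hg, indicator, mem_Ioo, hmono.lt_iff_lt hu hw,
        hmono.lt_iff_lt hw hv]
    · rw [indicator_of_notMem hw, indicator_of_notMem]
      exact fun h => hw ⟨hu.1.trans h.1, h.2.trans hv.2⟩
  have hfin : ∀ᵐ x : ℝ, p x < ∞ := ae_lt_top hp (by rw [hp1]; exact ENNReal.one_ne_top)
  have e2 : ∫⁻ x, p x * g x = ∫⁻ x, (Ioo (s u) (s v)).indicator 1 x := by
    refine lintegral_congr_ae ?_
    filter_upwards [hfin, measure_eq_zero_iff_ae_notMem.1 h0] with x hx hx0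
    by_cases hxs : x ∈ Ioo (s u) (s v)
    · simp only [hg, indicator_of_mem hxs, Pi.one_apply]
      exact ENNReal.mul_inv_cancel (fun h => hx0 ⟨h, hxs⟩) hx.ne
    · simp only [hg, indicator_of_notMem hxs, mul_zero]
  rw [e1, lintegral_quantile hp hp1 hgm, e2, lintegral_indicator_one measurableSet_Ioo,
    Real.volume_Ioo]

theorem exists_map_add_eq_of_ae_quantile_eq {p : Fin 2 → ℝ → ℝ≥0∞} (hp : ∀ i, Measurable (p i))
    (hp1 : ∀ i, ∫⁻ x, p i x = 1)
    (hac : ∀ i, ∀ t : ℝ, 0 < t → t < 1 →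
      ((volume.withDensity (p i)).prod (volume.withDensity (p i))).map
        (fun z => (1 - t) * z.1 + t * z.2) ≪ volume.withDensity (p i))
    (h : ∀ᵐ u ∂(volume.restrict (Ioo (0 : ℝ) 1)),
      p 0 (quantile (volume.withDensity (p 0)) u) = p 1 (quantile (volume.withDensity (p 1)) u)) :
    ∃ c : ℝ, volume.withDensity (p 1) = (volume.withDensity (p 0)).map (fun x => x + c) := by
  have hprob := fun i => isProbabilityMeasure_withDensity_of_lintegral (hp1 i)
  have hmono := fun i => strictMonoOn_quantile (withDensity_absolutelyContinuous volume (p i))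
  have hdiff : ∀ u ∈ Ioo (0 : ℝ) 1, ∀ v ∈ Ioo (0 : ℝ) 1, u < v →
      quantile (volume.withDensity (p 0)) v - quantile (volume.withDensity (p 0)) u =
      quantile (volume.withDensity (p 1)) v - quantile (volume.withDensity (p 1)) u := by
    intro u hu v hv huv
    rw [← ENNReal.ofReal_eq_ofReal_iff (sub_nonneg.2 (hmono 0 hu hv huv).le)
      (sub_nonneg.2 (hmono 1 hu hv huv).le), ofReal_quantile_sub (hp 0) (hp1 0) (hac 0) hu hv,
      ofReal_quantile_sub (hp 1) (hp1 1) (hac 1) hu hv]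
    refine lintegral_congr_ae ?_
    filter_upwards [ae_restrict_of_ae_restrict_of_subset
      (Ioo_subset_Ioo hu.1.le hv.2.le) h] with w hw
    rw [hw]
  have hhalf : (1 / 2 : ℝ) ∈ Ioo (0 : ℝ) 1 := by norm_num
  obtain ⟨c, hc⟩ : ∃ c, c = quantile (volume.withDensity (p 1)) (1 / 2) -
    quantile (volume.withDensity (p 0)) (1 / 2) := ⟨_, rfl⟩
  refine ⟨c, ?_⟩
  conv_lhs => rw [← map_quantile (volume.withDensity (p 1))]
  conv_rhs => rw [← map_quantile (volume.withDensity (p 0))]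
  rw [Measure.map_map (by fun_prop) (measurable_quantile_right _)]
  refine Measure.map_congr ?_
  filter_upwards [ae_restrict_mem measurableSet_Ioo] with u hu
  simp only [Function.comp_apply]
  rcases lt_trichotomy u (1 / 2) with hlt | rfl | hlt
  · linarith [hdiff u hu _ hhalf hlt]
  · linarith
  · linarith [hdiff _ hhalf u hu hlt]

theorem ext_of_map_inner {n : ℕ} {ρ ρ' : Measure (En n)} [IsProbabilityMeasure ρ]
    [IsProbabilityMeasure ρ']
    (h : ∀ e : En n, ‖e‖ = 1 → ρ.map (fun x => ⟪e, x⟫) = ρ'.map (fun x => ⟪e, x⟫)) : ρ = ρ' := by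
  refine Measure.ext_of_charFun (funext fun t => ?_)
  rcases eq_or_ne t 0 with rfl | ht
  · simp
  set e : En n := ‖t‖⁻¹ • t with he
  have hne : ‖t‖ ≠ 0 := norm_ne_zero_iff.2 ht
  have hin : Measurable (fun x : En n => ⟪e, x⟫) := by fun_prop
  have key : ∀ ν : Measure (En n), charFun ν t = charFun (ν.map fun x => ⟪e, x⟫) ‖t‖ := by
    intro ν
    rw [charFun_apply, charFun_apply_real, integral_map hin.aemeasurable (by fun_prop)]
    refine integral_congr_ae (ae_of_all _ fun x => ?_)
    simp only
    rw [← Complex.ofReal_mul, he, real_inner_smul_left, ← mul_assoc, mul_inv_cancel₀ hne, one_mul,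
      real_inner_comm]
  rw [key, key, h e (by rw [he, norm_smul, norm_inv, norm_norm, inv_mul_cancel₀ hne])]

theorem exists_map_inner_eq_map_add {k : ℕ} {N : ℝ} (hN : ((k + 1 : ℕ) : ℝ) + 1 < N)
    {μ : Measure (En (k + 1))} (hμ1 : P1 μ) {ρ : Fin 2 → Measure (En (k + 1))}
    [∀ i, IsProbabilityMeasure (ρ i)] (hρ1 : ∀ i, P1 (ρ i))
    {τ : Fin 2 → ℝ} (hτ : ∀ i, Tcorr (ρ i) μ ≤ τ i)
    (hmin : ∀ i ν, IsProbabilityMeasure ν → P1 ν → ∀ c : ℝ, Tcorr ν μ ≤ c →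
      (powInt (1 - 1 / N) ν).toReal ≤ (powInt (1 - 1 / N) (ρ i)).toReal + (1 - 1 / N) * (c - τ i))
    {e : En (k + 1)} (he : ‖e‖ = 1) :
    ∃ c : ℝ, (ρ 1).map (fun x => ⟪e, x⟫) = ((ρ 0).map (fun x => ⟪e, x⟫)).map (fun x => x + c) := by
  have hac := fun i => absolutelyContinuous_of_powInt_le hN hμ1 (hρ1 i) (hτ i) (hmin i)
  obtain ⟨p, hp, hp1, hlaw, heq⟩ := exists_directional_densities hN hμ1 hρ1 hac hτ hmin he
  rw [hlaw, hlaw]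
  refine exists_map_add_eq_of_ae_quantile_eq hp hp1 (fun i t ht0 ht1 => ?_) heq
  have hin : Measurable (fun x : En (k + 1) => ⟪e, x⟫) := by fun_prop
  have h := (map_interp_prod_absolutelyContinuous_self hN hμ1 (hρ1 i) (hτ i) (hmin i) ht0 ht1).map
    hin
  rw [Measure.map_map hin (by fun_prop)] at h
  rw [← hlaw, Measure.map_prod_map _ _ hin hin, Measure.map_map (by fun_prop) (by fun_prop)]
  have hcomp : (fun z : ℝ × ℝ => (1 - t) * z.1 + t * z.2) ∘
      Prod.map (fun x : En (k + 1) => ⟪e, x⟫) (fun x : En (k + 1) => ⟪e, x⟫) =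
      (fun x : En (k + 1) => ⟪e, x⟫) ∘ fun p => (1 - t) • p.1 + t • p.2 := by
    funext z
    simp [inner_add_right, inner_smul_right]
  rw [hcomp]
  exact h

theorem eq_map_add_of_map_inner {n : ℕ} {ρ₀ ρ₁ : Measure (En n)} [IsProbabilityMeasure ρ₀]
    [IsProbabilityMeasure ρ₁] (h₀ : P1 ρ₀) (h₁ : P1 ρ₁)
    (h : ∀ e : En n, ‖e‖ = 1 →
      ∃ c : ℝ, ρ₁.map (fun x => ⟪e, x⟫) = (ρ₀.map (fun x => ⟪e, x⟫)).map (fun x => x + c)) :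
    ρ₁ = ρ₀.map (fun x => x + (∫ y, y ∂ρ₁ - ∫ y, y ∂ρ₀)) := by
  have hi₀ : Integrable (fun x : En n => x) ρ₀ :=
    (integrable_norm_iff (by fun_prop)).1 h₀
  have hi₁ : Integrable (fun x : En n => x) ρ₁ :=
    (integrable_norm_iff (by fun_prop)).1 h₁
  set v := ∫ y, y ∂ρ₁ - ∫ y, y ∂ρ₀ with hv
  have : IsProbabilityMeasure (ρ₀.map (fun x => x + v)) :=
    Measure.isProbabilityMeasure_map (by fun_prop)
  refine ext_of_map_inner fun e he => ?_
  obtain ⟨c, hc⟩ := h e he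
  have hin : Measurable (fun x : En n => ⟪e, x⟫) := by fun_prop
  have h2 : ⟪e, ∫ y, y ∂ρ₁⟫ = ⟪e, ∫ y, y ∂ρ₀⟫ + c := by
    have e1 : ∫ y, y ∂(ρ₁.map (fun x => ⟪e, x⟫)) = ⟪e, ∫ y, y ∂ρ₁⟫ := by
      rw [integral_map hin.aemeasurable (by fun_prop), ← integral_inner hi₁ e]
    have e2 : ∫ y, y ∂((ρ₀.map (fun x => ⟪e, x⟫)).map (fun x => x + c)) =
        ⟪e, ∫ y, y ∂ρ₀⟫ + c := by
      rw [integral_map (by fun_prop) (by fun_prop), integral_map hin.aemeasurable (by fun_prop),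
        integral_add (hi₀.const_inner e) (integrable_const c), ← integral_inner hi₀ e]
      simp
    rw [← e1, ← e2, hc]
  have hcv : c = ⟪e, v⟫ := by rw [hv, inner_sub_right]; linarith
  rw [hc, Measure.map_map (by fun_prop) hin, Measure.map_map hin (by fun_prop)]
  congr 1 with x
  simp [inner_add_right, hcv]

/-- Uniqueness of the minimizer up to translations. -/
theorem qMomentMeasures_uniqueness_up_to_translation
    (n : ℕ) (hn : 1 ≤ n) (q : ℝ) (hq : 1 < q)
    (μ : Measure (En n)) [IsProbabilityMeasure μ]
    (hμ1 : P1 μ) (hbar : ∫ y, y ∂μ = (0 : En n)) (hplane : NotHyperplane μ)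
    (ρ₀ ρ₁ : Measure (En n)) [IsProbabilityMeasure ρ₀] [IsProbabilityMeasure ρ₁]
    (hρ₀1 : P1 ρ₀) (hρ₁1 : P1 ρ₁)
    (hmin₀ : ∀ ρ : Measure (En n), IsProbabilityMeasure ρ → P1 ρ →
      Jfun n q μ ρ₀ ≤ Jfun n q μ ρ)
    (hmin₁ : ∀ ρ : Measure (En n), IsProbabilityMeasure ρ → P1 ρ →
      Jfun n q μ ρ₁ ≤ Jfun n q μ ρ) :
    ∃ v : En n, ρ₁ = ρ₀.map (fun x => x + v) := by
  obtain ⟨k, rfl⟩ : ∃ k, n = k + 1 := ⟨n - 1, by omega⟩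
  obtain ⟨τ₀, hτ₀, h₀⟩ := powInt_le_of_isMin hq hμ1 hρ₀1 hmin₀
  obtain ⟨τ₁, hτ₁, h₁⟩ := powInt_le_of_isMin hq hμ1 hρ₁1 hmin₁
  have hprob : ∀ i, IsProbabilityMeasure ((![ρ₀, ρ₁] : Fin 2 → Measure (En (k + 1))) i) := by
    rw [Fin.forall_fin_two]
    exact ⟨inferInstanceAs (IsProbabilityMeasure ρ₀), inferInstanceAs (IsProbabilityMeasure ρ₁)⟩
  exact ⟨_, eq_map_add_of_map_inner hρ₀1 hρ₁1 fun e he =>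
    exists_map_inner_eq_map_add (N := ((k + 1 : ℕ) : ℝ) + q) (by linarith) hμ1
      (ρ := ![ρ₀, ρ₁]) (τ := ![τ₀, τ₁]) (Fin.forall_fin_two.2 ⟨hρ₀1, hρ₁1⟩)
      (Fin.forall_fin_two.2 ⟨hτ₀, hτ₁⟩) (Fin.forall_fin_two.2 ⟨h₀, h₁⟩) he⟩

end
end

section
/- Let n ≥ 1 and q > 1, and set α := 1 − 1/(n+q). Then for each δ ∈ (n/(n+q−1), 1) there exists a constant C = C(n,q,δ) such that for every probability measure ρ on ℝⁿ with finite first moment M_1(ρ) = ∫|x|dρ(x) one has F(ρ) ≥ −C − M_1(ρ)^δ. -/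
open MeasureTheory Topology Filter Set
open scoped ENNReal RealInnerProductSpace

noncomputable section

/-- Weighted Young inequality: `u ^ α / α ≤ u * w ^ δ + (1 - α) / α * w ^ (-(δ * (N - 1)))`
for `α = 1 - 1 / N`. -/
lemma rpow_div_le_add_weight {N δ u w : ℝ} (hN : 1 < N) (hu : 0 ≤ u) (hw : 0 < w) :
    u ^ (1 - 1 / N) / (1 - 1 / N) ≤
      u * w ^ δ + (1 / N) / (1 - 1 / N) * w ^ (-(δ * (N - 1))) := by
  have hN0 : 0 < N := by linarith
  have hα : 0 < 1 - 1 / N := by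
    rw [sub_pos, div_lt_one hN0]
    exact hN
  have young := Real.geom_mean_le_arith_mean2_weighted hα.le (by positivity : 0 ≤ 1 / N)
    (by positivity : 0 ≤ u * w ^ δ) (by positivity : 0 ≤ w ^ (-(δ * (N - 1)))) (by ring)
  have hprod : (u * w ^ δ) ^ (1 - 1 / N) * (w ^ (-(δ * (N - 1)))) ^ (1 / N)
      = u ^ (1 - 1 / N) := by
    rw [Real.mul_rpow hu (by positivity), ← Real.rpow_mul hw.le, ← Real.rpow_mul hw.le,
      mul_assoc, ← Real.rpow_add hw]
    have : δ * (1 - 1 / N) + -(δ * (N - 1)) * (1 / N) = 0 := by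
      field_simp
      ring
    rw [this, Real.rpow_zero, mul_one]
  rw [hprod] at young
  rw [div_le_iff₀ hα]
  refine young.trans_eq ?_
  have hcancel : (1 / N) / (1 - 1 / N) * (1 - 1 / N) = 1 / N := div_mul_cancel₀ _ hα.ne'
  linear_combination -w ^ (-(δ * (N - 1))) * hcancel

/-- The absolutely continuous part of `ρ` integrates nonnegative functions to at most
their `ρ`-integral. -/
lemma lintegral_rnDeriv_mul_le_lintegral {X : Type*} [MeasurableSpace X] (ρ ν : Measure X)
    {g : X → ℝ≥0∞} (hg : Measurable g) :
    ∫⁻ x, ρ.rnDeriv ν x * g x ∂ν ≤ ∫⁻ x, g x ∂ρ := by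
  calc ∫⁻ x, ρ.rnDeriv ν x * g x ∂ν
      = ∫⁻ x, g x ∂(ν.withDensity (ρ.rnDeriv ν)) :=
        (lintegral_withDensity_eq_lintegral_mul ν (Measure.measurable_rnDeriv ρ ν) hg).symm
    _ ≤ ∫⁻ x, g x ∂ρ := lintegral_mono' (Measure.withDensity_rnDeriv_le ρ ν) le_rfl

/-- Jensen's inequality for the weight `(1 + ‖x‖) ^ δ` with `0 < δ < 1`. -/
lemma lintegral_one_add_norm_rpow_le {E : Type*} [NormedAddCommGroup E] [MeasurableSpace E]
    (ρ : Measure E) [IsProbabilityMeasure ρ]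
    (hρ : Integrable (fun x : E => ‖x‖) ρ) {δ : ℝ} (hδ0 : 0 < δ) (hδ1 : δ < 1) :
    ∫⁻ x, ENNReal.ofReal ((1 + ‖x‖) ^ δ) ∂ρ ≤ ENNReal.ofReal (1 + (∫ x, ‖x‖ ∂ρ) ^ δ) := by
  have hpow : Integrable (fun x : E => ‖x‖ ^ δ) ρ := by
    refine Integrable.mono' ((integrable_const (1 : ℝ)).add hρ)
      ((hρ.aemeasurable.pow_const δ).aestronglyMeasurable) (ae_of_all _ fun x => ?_)
    rw [Real.norm_of_nonneg (by positivity)]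
    calc ‖x‖ ^ δ ≤ (1 + ‖x‖) ^ δ := by gcongr; linarith
      _ ≤ (1 + ‖x‖) ^ (1 : ℝ) :=
        Real.rpow_le_rpow_of_exponent_le (by linarith [norm_nonneg x]) hδ1.le
      _ = 1 + ‖x‖ := Real.rpow_one _
  have jensen : ∫ x, ‖x‖ ^ δ ∂ρ ≤ (∫ x, ‖x‖ ∂ρ) ^ δ :=
    (Real.concaveOn_rpow hδ0.le hδ1.le).le_map_integral
      (Real.continuous_rpow_const hδ0.le).continuousOn isClosed_Ici
      (ae_of_all _ fun x => norm_nonneg x) hρ hpow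
  calc ∫⁻ x, ENNReal.ofReal ((1 + ‖x‖) ^ δ) ∂ρ
      ≤ ∫⁻ x, ENNReal.ofReal (1 + ‖x‖ ^ δ) ∂ρ := by
        refine lintegral_mono fun x => ENNReal.ofReal_le_ofReal ?_
        simpa using Real.rpow_add_le_add_rpow zero_le_one (norm_nonneg x) hδ0.le hδ1.le
    _ = ENNReal.ofReal (∫ x, (1 + ‖x‖ ^ δ) ∂ρ) :=
        (ofReal_integral_eq_lintegral_ofReal ((integrable_const (1 : ℝ)).add hpow)
          (ae_of_all _ fun x => add_nonneg zero_le_one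
            (Real.rpow_nonneg (norm_nonneg x) δ))).symm
    _ ≤ ENNReal.ofReal (1 + (∫ x, ‖x‖ ∂ρ) ^ δ) := by
        refine ENNReal.ofReal_le_ofReal ?_
        rw [integral_add (integrable_const (1 : ℝ)) hpow]
        simpa using jensen

/-- Lower bound for the local functional:
`F(ρ) ≥ -C - M₁(ρ)^δ` for every `δ ∈ (n/(n+q-1), 1)`. -/
theorem qMomentMeasures_F_lower_bound
    (n : ℕ) (hn : 1 ≤ n) (q : ℝ) (hq : 1 < q)
    (δ : ℝ) (hδl : (n : ℝ) / ((n : ℝ) + q - 1) < δ) (hδu : δ < 1) :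
    ∃ C : ℝ, ∀ ρ : Measure (En n), IsProbabilityMeasure ρ → P1 ρ →
      ((-C - (∫ x, ‖x‖ ∂ρ) ^ δ : ℝ) : EReal) ≤ Ffun n q ρ := by
  have hn1 : (1 : ℝ) ≤ n := by exact_mod_cast hn
  have hN : 1 < (n : ℝ) + q := by linarith
  have hδ0 : 0 < δ := lt_of_le_of_lt (div_nonneg (by linarith) (by linarith)) hδl
  have hdim : (Module.finrank ℝ (En n) : ℝ) < δ * ((n : ℝ) + q - 1) := by
    rw [finrank_euclideanSpace_fin]
    exact (div_lt_iff₀ (by linarith)).1 hδl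
  set N : ℝ := (n : ℝ) + q
  have hα : 0 < 1 - 1 / N := by
    rw [sub_pos, div_lt_one (by linarith)]
    exact hN
  have hNpos : 0 < N := by linarith
  set tail : En n → ℝ := fun x => (1 / N) / (1 - 1 / N) * (1 + ‖x‖) ^ (-(δ * (N - 1)))
  have tail_nonneg : ∀ x, 0 ≤ tail x := fun x => by positivity
  have tail_int : Integrable tail := (integrable_one_add_norm hdim).const_mul _
  have hK : 0 ≤ ∫ x, tail x := integral_nonneg tail_nonneg
  refine ⟨1 + ∫ x, tail x, fun ρ _ hρ => ?_⟩
  have hM : 0 ≤ (∫ x, ‖x‖ ∂ρ) ^ δ :=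
    Real.rpow_nonneg (integral_nonneg fun x => norm_nonneg x) δ
  have weight_meas : Measurable fun x : En n => ENNReal.ofReal ((1 + ‖x‖) ^ δ) := by fun_prop
  have key : ∫⁻ x, ENNReal.ofReal
        ((ρ.rnDeriv volume x).toReal ^ (1 - 1 / N) / (1 - 1 / N)) ∂(volume : Measure (En n))
      ≤ ENNReal.ofReal (1 + (∫ x, tail x) + (∫ x, ‖x‖ ∂ρ) ^ δ) := by
    calc _ ≤ ∫⁻ x, (ρ.rnDeriv volume x * ENNReal.ofReal ((1 + ‖x‖) ^ δ)
              + ENNReal.ofReal (tail x)) ∂(volume : Measure (En n)) := by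
          refine lintegral_mono fun x => ?_
          refine (ENNReal.ofReal_le_ofReal (rpow_div_le_add_weight (δ := δ) hN
            ENNReal.toReal_nonneg (by positivity : 0 < 1 + ‖x‖))).trans ?_
          rw [ENNReal.ofReal_add (by positivity) (tail_nonneg x),
            ENNReal.ofReal_mul ENNReal.toReal_nonneg]
          gcongr
          exact ENNReal.ofReal_toReal_le
      _ = ∫⁻ x, ρ.rnDeriv volume x * ENNReal.ofReal ((1 + ‖x‖) ^ δ) ∂(volume : Measure (En n))
            + ENNReal.ofReal (∫ x, tail x) := by
          have prod_meas : Measurable fun x : En n =>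
              ρ.rnDeriv volume x * ENNReal.ofReal ((1 + ‖x‖) ^ δ) :=
            (Measure.measurable_rnDeriv ρ volume).mul weight_meas
          rw [lintegral_add_left prod_meas,
            ofReal_integral_eq_lintegral_ofReal tail_int (ae_of_all _ tail_nonneg)]
      _ ≤ ENNReal.ofReal (1 + (∫ x, ‖x‖ ∂ρ) ^ δ) + ENNReal.ofReal (∫ x, tail x) := by
          gcongr
          exact (lintegral_rnDeriv_mul_le_lintegral ρ volume weight_meas).trans
            (lintegral_one_add_norm_rpow_le ρ hρ hδ0 hδu)
      _ = ENNReal.ofReal (1 + (∫ x, tail x) + (∫ x, ‖x‖ ∂ρ) ^ δ) := by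
          rw [← ENNReal.ofReal_add (by positivity) hK]
          congr 1
          ring
  have hreal : -(1 + ∫ x, tail x) - (∫ x, ‖x‖ ∂ρ) ^ δ
      = -(1 + (∫ x, tail x) + (∫ x, ‖x‖ ∂ρ) ^ δ) := by ring
  rw [hreal, EReal.coe_neg, Ffun, EReal.neg_le_neg_iff]
  refine (EReal.coe_ennreal_le_coe_ennreal_iff.2 key).trans_eq ?_
  rw [EReal.coe_ennreal_ofReal, max_eq_left (by positivity)]

end
end
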